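/- arXiv:math/0301073 — 2 statements merged into one kernel-verified Lean document; each statement's English description precedes it below -/
import Mathlib

section
/- For every n ≥ 1 and every r > 0, the open ball B_r ⊂ ℝ^{2n} of radius r centered at the origin satisfies c_HZ(B_r, {0}) = π r². -/
open scoped RealInnerProductSpace ENNReal NNReal Topology
open Metric Set

noncomputable section

/-- `ℝ^{2n}` identified with `ℂ^n`, with the standard (real) inner product and
the standard complex structure `J` given by multiplication by `i`. -/
abbrev Esp (n : ℕ) := EuclideanSpace ℂ (Fin n)

variable {n : ℕ}

/-- The Hamiltonian vector field `X_H = J ∇H` of `H : ℝ^{2n} → ℝ`. -/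
def hamVF (H : Esp n → ℝ) (x : Esp n) : Esp n := Complex.I • gradient H x

/-- A nonconstant `T`-periodic orbit of the Hamiltonian flow of `H`:
a nonconstant solution `γ` of `γ' = J∇H(γ)` with `γ (t + T) = γ t`. -/
def IsPeriodicOrbit (H : Esp n → ℝ) (γ : ℝ → Esp n) (T : ℝ) : Prop :=
  0 < T ∧ (∀ t, HasDerivAt γ (hamVF H (γ t)) t) ∧
    (∀ t, γ (t + T) = γ t) ∧ ∃ t₀ t₁, γ t₀ ≠ γ t₁

/-- `H` has a fast (period `≤ 1`) nonconstant periodic orbit. -/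
def HasFastOrbit (H : Esp n → ℝ) : Prop :=
  ∃ γ T, IsPeriodicOrbit H γ T ∧ T ≤ 1

/-- The symplectic action of a `1`-periodic loop `γ` with respect to the
(possibly time-dependent) Hamiltonian `H`:
`A_H(γ) = -(1/2)∫₀¹ ⟨Jγ(t), γ'(t)⟩ dt + ∫₀¹ H(t, γ(t)) dt`. -/
def action (H : ℝ → Esp n → ℝ) (γ : ℝ → Esp n) : ℝ :=
  -(1 / 2) * (∫ t in (0:ℝ)..1, ⟪(Complex.I • γ t : Esp n), deriv γ t⟫) +
    ∫ t in (0:ℝ)..1, H t (γ t)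

/-- The class `𝓗(V, Z)`: smooth functions on `ℝ^{2n}` with compact support
contained in `V`, constant on a neighborhood of `Z`, whose value on `Z` is the
maximum of `H`. -/
def InHclass (V Z : Set (Esp n)) (H : Esp n → ℝ) : Prop :=
  ContDiff ℝ (⊤ : ℕ∞) H ∧ IsCompact (tsupport H) ∧ tsupport H ⊆ V ∧
    (∃ U, IsOpen U ∧ Z ⊆ U ∧ ∃ c : ℝ, ∀ x ∈ U, H x = c) ∧
    ∀ z ∈ Z, ∀ x, H x ≤ H z

/-- The relative Hofer–Zehnder capacity `c_HZ(V, Z)`: the supremum of `max H`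
over all `H ∈ 𝓗(V, Z)` having no fast nonconstant periodic orbit (for `z ∈ Z`,
`H z = max H`). -/
def relCap (V Z : Set (Esp n)) : ℝ≥0∞ :=
  sSup {c | ∃ H, InHclass V Z H ∧ ¬ HasFastOrbit H ∧
    ∃ z ∈ Z, c = ENNReal.ofReal (H z)}

section
open MeasureTheory Set Metric

lemma det_interp {V : Type*} [NormedAddCommGroup V] [InnerProductSpace ℝ V]
    [FiniteDimensional ℝ V] (A : V →L[ℝ] V) (v : ℕ → ℝ) (hv : Function.Injective v) :
    (1 + A).det = ∑ j ∈ Finset.range (Module.finrank ℝ V + 1),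
      (Lagrange.basis (Finset.range (Module.finrank ℝ V + 1)) v j).eval 1 * (1 + v j • A).det := by
  classical
  set m := Module.finrank ℝ V with hm
  let b : Module.Basis (Fin m) ℝ V := Module.finBasis ℝ V
  let M := LinearMap.toMatrix b b (A : V →ₗ[ℝ] V)
  let f : Polynomial ℝ := Matrix.det ((Polynomial.X : Polynomial ℝ) • M.map Polynomial.C
    + (1 : Matrix (Fin m) (Fin m) ℝ).map Polynomial.C)
  have hf : ∀ t : ℝ, f.eval t = (1 + t • A).det := by
    intro t
    have h1 : (1 + t • A).det = LinearMap.det (1 + t • (A : V →ₗ[ℝ] V)) := rfl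
    rw [h1, ← LinearMap.det_toMatrix b]
    simp only [f]
    rw [← Polynomial.coe_evalRingHom, RingHom.map_det]
    congr 1
    ext i j
    simp only [RingHom.mapMatrix_apply, Matrix.map_apply, Matrix.add_apply, Matrix.smul_apply,
      map_add, smul_eq_mul, Polynomial.coe_evalRingHom,
      Polynomial.eval_C, map_smul, LinearMap.toMatrix_one]
    rw [add_comm, Polynomial.eval_mul, Polynomial.eval_X, Polynomial.eval_C]
  have hdeg : f.degree < (Finset.range (m + 1)).card := by
    have := Polynomial.natDegree_det_X_add_C_le M (1 : Matrix (Fin m) (Fin m) ℝ)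
    rw [Fintype.card_fin] at this
    refine lt_of_le_of_lt Polynomial.degree_le_natDegree ?_
    rw [Finset.card_range]
    exact_mod_cast Nat.lt_succ_of_le this
  have key := Lagrange.eq_interpolate (s := Finset.range (m+1)) (v := v) (hv.injOn) hdeg
  have h1 := congrArg (Polynomial.eval 1) key
  rw [Lagrange.interpolate_apply, Polynomial.eval_finsetSum, hf] at h1
  rw [one_smul] at h1
  rw [h1]
  refine Finset.sum_congr rfl fun j _ => ?_
  rw [Polynomial.eval_mul, Polynomial.eval_C, hf, mul_comm]

lemma det_pos_of_small {V : Type*} [NormedAddCommGroup V] [InnerProductSpace ℝ V]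
    [FiniteDimensional ℝ V] (A : V →L[ℝ] V) (t : ℝ) (ht : 0 ≤ t) (h : t * ‖A‖ < 1) :
    0 < (1 + t • A).det := by
  by_contra hc
  push Not at hc
  have hcont : Continuous fun s : ℝ => (1 + s • A).det := by
    have : Continuous fun s : ℝ => (1 + s • A : V →L[ℝ] V) := by fun_prop
    exact ContinuousLinearMap.continuous_det.comp this
  have h0 : (1 + (0:ℝ) • A).det = 1 := by
    rw [zero_smul, add_zero]; exact LinearMap.det_id
  obtain ⟨s, hs, hs0⟩ := intermediate_value_Icc' ht hcont.continuousOn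
    (⟨hc, by rw [h0]; exact zero_le_one⟩ : (0:ℝ) ∈ Icc _ _)
  have hs1 : LinearMap.det ((1 + s • A : V →L[ℝ] V) : V →ₗ[ℝ] V) = 0 := hs0
  have := LinearMap.bot_lt_ker_of_det_eq_zero hs1
  obtain ⟨w, hw, hw0⟩ := (Submodule.ne_bot_iff _).1 this.ne'
  have hw1 : w + s • A w = 0 := by simpa using hw
  have hw2 : ‖w‖ = s * ‖A w‖ := by
    rw [eq_neg_of_add_eq_zero_left hw1, norm_neg, norm_smul, Real.norm_of_nonneg hs.1]
    rw [← eq_neg_of_add_eq_zero_left hw1]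
  have hwp : 0 < ‖w‖ := norm_pos_iff.2 hw0
  have h3 : s * ‖A w‖ ≤ t * (‖A‖ * ‖w‖) :=
    mul_le_mul hs.2 (A.le_opNorm w) (norm_nonneg _) ht
  nlinarith

lemma milnor_core {V : Type*} [NormedAddCommGroup V] [InnerProductSpace ℝ V]
    [FiniteDimensional ℝ V] (u : V → V) (u' : V → V →L[ℝ] V) (K : NNReal)
    (hK : LipschitzWith K u) (R : ℝ) (hR : 0 < R) (hout : ∀ x, R ≤ ‖x‖ → u x = 0)
    (hder : ∀ x, ‖x‖ < R → HasFDerivAt u (u' x) x)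
    (hnorm : ∀ x, ‖x‖ < R → ‖x + u x‖ = R) : False := by
  classical
  borelize V
  let μ : Measure V := Measure.addHaar
  set B := ball (0:V) R
  set m := Module.finrank ℝ V
  -- small times
  have bij : ∀ t : ℝ, 0 ≤ t → t * K < 1 →
      IntegrableOn (fun x => (1 + t • u' x).det) B μ ∧
      ∫ x in B, (1 + t • u' x).det ∂μ = μ.real B := by
    intro t ht htK
    set g : V → V := fun x => x + t • u x
    have hinj : Function.Injective g := by
      intro x y hxy
      by_contra hne
      have h1 : x - y = t • (u y - u x) := by
        have : x + t • u x = y + t • u y := hxy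
        rw [smul_sub, sub_eq_sub_iff_add_eq_add, add_comm _ y]; exact this
      have h2 : ‖x - y‖ ≤ t * (K * ‖x - y‖) := by
        have h3 := hK.dist_le_mul y x
        rw [dist_eq_norm, dist_eq_norm, norm_sub_rev y x] at h3
        calc ‖x - y‖ = t * ‖u y - u x‖ := by
              conv_lhs => rw [h1]
              rw [norm_smul, Real.norm_of_nonneg ht]
          _ ≤ _ := by gcongr
      have : 0 < ‖x - y‖ := norm_pos_iff.2 (sub_ne_zero.2 hne)
      nlinarith
    have hsurj : Function.Surjective g := by
      intro y
      have hc : ContractingWith (t.toNNReal * K) (fun x => y - t • u x) := by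
        refine ⟨?_, ?_⟩
        · rw [← NNReal.coe_lt_coe]; simpa [ht] using htK
        · refine LipschitzWith.of_dist_le_mul fun a b => ?_
          rw [dist_sub_left, dist_smul₀, Real.norm_of_nonneg ht]
          have := hK.dist_le_mul a b
          rw [NNReal.coe_mul, Real.coe_toNNReal t ht]
          rw [mul_assoc]; gcongr
      obtain ⟨x, hx, -⟩ := hc.exists_fixedPoint y (edist_ne_top _ _)
      refine ⟨x, ?_⟩
      have : y - t • u x = x := hx
      simp only [g]
      nth_rw 1 [← this]; abel
    have himg : g '' B = B := by
      have hgo : ∀ x, x ∉ B → g x = x := by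
        intro x hx
        have : R ≤ ‖x‖ := by simpa [B] using hx
        simp [g, hout x this]
      ext y
      constructor
      · rintro ⟨x, hx, rfl⟩
        by_contra hc
        have := hinj (hgo _ hc)
        rw [this] at hc; exact hc hx
      · intro hy
        obtain ⟨x, rfl⟩ := hsurj y
        refine ⟨x, ?_, rfl⟩
        by_contra hc
        rw [hgo x hc] at hy; exact hc hy
    have hd : ∀ x ∈ B, HasFDerivWithinAt g (1 + t • u' x) B x := by
      intro x hx
      have hx' : ‖x‖ < R := by simpa [B] using hx
      exact ((hasFDerivAt_id x).add ((hder x hx').const_smul t)).hasFDerivWithinAt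
    have hpos : ∀ x ∈ B, |(1 + t • u' x).det| • (1:ℝ) = (1 + t • u' x).det := by
      intro x hx
      have hx' : ‖x‖ < R := by simpa [B] using hx
      have := (hder x hx').le_of_lipschitz hK
      rw [smul_eq_mul, mul_one, abs_of_pos]
      apply det_pos_of_small _ _ ht
      exact lt_of_le_of_lt (by gcongr) htK
    have e1 := integral_image_eq_integral_abs_det_fderiv_smul μ measurableSet_ball hd
      hinj.injOn (fun _ => (1:ℝ))
    have e2 := integrableOn_image_iff_integrableOn_abs_det_fderiv_smul μ measurableSet_ball hd
      hinj.injOn (fun _ => (1:ℝ))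
    rw [himg] at e1 e2
    constructor
    · refine IntegrableOn.congr_fun (e2.1 ?_) hpos measurableSet_ball
      exact integrableOn_const (measure_ball_lt_top).ne
    · rw [setIntegral_congr_fun measurableSet_ball hpos] at e1
      rw [← e1]; simp
  -- interpolation nodes
  let v : ℕ → ℝ := fun j => 1 / ((j + 1) * (K + 1))
  have hv : Function.Injective v := by
    intro i j hij
    have hK1 : (0:ℝ) < K + 1 := by positivity
    simp only [v] at hij
    have h1 : ((i:ℝ) + 1) * (K+1) = (j+1) * (K+1) := by
      have := congrArg (fun z => 1 / z) hij
      simpa using this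
    have := mul_right_cancel₀ hK1.ne' h1
    exact_mod_cast (add_right_cancel this)
  have hv0 : ∀ j, 0 ≤ v j ∧ v j * K < 1 := by
    intro j
    have : (0:ℝ) ≤ K := K.2
    refine ⟨by positivity, ?_⟩
    simp only [v]
    rw [one_div_mul_eq_div, div_lt_one (by positivity)]
    have : (0:ℝ) ≤ j := by positivity
    nlinarith
  set w : ℕ → ℝ := fun j => (Lagrange.basis (Finset.range (m + 1)) v j).eval 1
  have hw : ∑ j ∈ Finset.range (m+1), w j = 1 := by
    have := Lagrange.sum_basis (s := Finset.range (m+1)) (v := v) hv.injOn (by simp)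
    have := congrArg (Polynomial.eval 1) this
    rwa [Polynomial.eval_finsetSum, Polynomial.eval_one] at this
  have hinteg : ∫ x in B, (1 + u' x).det ∂μ = μ.real B := by
    have h1 : ∀ x, (1 + u' x).det = ∑ j ∈ Finset.range (m+1), w j * (1 + v j • u' x).det :=
      fun x => det_interp (u' x) v hv
    simp_rw [h1]
    rw [integral_finsetSum]
    · simp_rw [integral_const_mul]
      rw [Finset.sum_congr rfl (fun j _ => by rw [(bij (v j) (hv0 j).1 (hv0 j).2).2]),
        ← Finset.sum_mul, hw, one_mul]
    · intro j _
      exact (bij (v j) (hv0 j).1 (hv0 j).2).1.const_mul _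
  have hzero : ∀ x ∈ B, (1 + u' x).det = 0 := by
    intro x hx
    have hx' : ‖x‖ < R := by simpa [B] using hx
    by_contra hc
    have hc' : IsUnit (LinearMap.det ((1 + u' x : V →L[ℝ] V) : V →ₗ[ℝ] V)) := isUnit_iff_ne_zero.2 hc
    have hsur : Function.Surjective (1 + u' x : V →L[ℝ] V) := by
      have := (LinearMap.isUnit_iff_isUnit_det _).2 hc'
      exact ((Module.End.isUnit_iff _).1 this).2
    have hd : HasFDerivAt (fun y => y + u y) (1 + u' x) x := (hasFDerivAt_id x).add (hder x hx')
    have hd2 := hd.norm_sq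
    have hconst : (fun y => ‖y + u y‖ ^ 2) =ᶠ[nhds x] fun _ => R ^ 2 := by
      filter_upwards [isOpen_ball.mem_nhds hx] with y hy
      rw [hnorm y (by simpa [B] using hy)]
    have hd3 := (hasFDerivAt_const (𝕜 := ℝ) (R^2) x).congr_of_eventuallyEq hconst
    have := hd2.unique hd3
    obtain ⟨z, hz⟩ := hsur (x + u x)
    have h4 := congrArg (fun l => l z) this
    simp at h4 hz
    have h5 : inner ℝ (x + u x) (z + u' x z) = R ^ 2 := by
      rw [hz, real_inner_self_eq_norm_sq, hnorm x hx']
    simp only [inner_add_left, inner_add_right] at h5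
    have : 0 < R ^ 2 := by positivity
    linarith
  rw [setIntegral_congr_fun measurableSet_ball hzero] at hinteg
  simp at hinteg
  have hpos : 0 < μ B := measure_ball_pos μ _ hR
  have hfin : μ B < ⊤ := measure_ball_lt_top
  have := (ENNReal.toReal_pos hpos.ne' hfin.ne)
  rw [Measure.real] at hinteg
  linarith

end

section
open MeasureTheory Set Metric

lemma brouwer_zero {V : Type*} [NormedAddCommGroup V] [InnerProductSpace ℝ V]
    [FiniteDimensional ℝ V] (F : V → V) (hF : Continuous F) (R₀ : ℝ)
    (hid : ∀ x, R₀ ≤ ‖x‖ → F x = x) : ∃ x, F x = 0 := by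
  classical
  by_contra hne
  push Not at hne
  set R : ℝ := max R₀ 0 + 1
  have hR : 0 < R := by positivity
  have hRR : R₀ ≤ R := by
    have := le_max_left R₀ 0
    simp only [R]; linarith
  obtain ⟨c, hc, hcF⟩ : ∃ c > 0, ∀ x, c ≤ ‖F x‖ := by
    obtain ⟨x₀, -, hx₀⟩ := (isCompact_closedBall (0:V) R).exists_isMinOn
      ⟨0, by simp [hR.le]⟩ (hF.norm.continuousOn)
    refine ⟨min ‖F x₀‖ R, lt_min (norm_pos_iff.2 (hne _)) hR, fun x => ?_⟩
    by_cases hx : ‖x‖ ≤ R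
    · exact (min_le_left _ _).trans (hx₀ (by simpa using hx))
    · push Not at hx
      rw [hid x (hRR.trans hx.le)]
      exact (min_le_right _ _).trans hx.le
  obtain ⟨u₀, hu₀, happ, hsupp⟩ := (hF.sub continuous_id).exists_contDiff_approx 1
    (ε := fun _ => c) continuous_const (fun _ => hc)
  have hu₀z : ∀ x, R₀ ≤ ‖x‖ → u₀ x = 0 := by
    intro x hx
    by_contra h
    have := hsupp (Function.mem_support.2 h)
    simp [hid x hx] at this
  have hFt : ∀ x, x + u₀ x ≠ 0 := by
    intro x hx
    have h1 := happ x
    rw [eq_neg_of_add_eq_zero_right hx, dist_eq_norm] at h1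
    have h2 := hcF x
    simp only [Pi.sub_apply, id] at h1
    rw [show -x - (F x - x) = - F x by abel, norm_neg] at h1
    linarith
  have hu₁ : ContDiff ℝ 1 u₀ := by exact_mod_cast hu₀
  have hFc : ContDiff ℝ 1 (fun x => x + u₀ x) := contDiff_id.add hu₁
  set v : V → V := fun x => (R / ‖x + u₀ x‖) • (x + u₀ x) - x
  have hv : ContDiff ℝ 1 v := by
    refine ContDiff.sub (ContDiff.smul ?_ hFc) contDiff_id
    exact contDiff_const.div (hFc.norm ℝ hFt) (fun x => norm_ne_zero_iff.2 (hFt x))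
  have hvS : ∀ x, ‖x‖ = R → v x = 0 := by
    intro x hx
    simp only [v]
    rw [hu₀z x (hx ▸ hRR), add_zero, hx, div_self hR.ne', one_smul, sub_self]
  obtain ⟨K, hK⟩ := hv.contDiffOn.exists_lipschitzOnWith (s := closedBall (0:V) R) one_ne_zero
    (convex_closedBall _ _) (isCompact_closedBall _ _)
  set u : V → V := fun x => if ‖x‖ < R then v x else 0
  have hucl : ∀ x, ‖x‖ ≤ R → u x = v x := by
    intro x hx
    rcases hx.lt_or_eq with h | h
    · simp [u, h]
    · simp [u, h, hvS x h]
  have key : ∀ x y, ‖x‖ ≤ R → R < ‖y‖ → dist (u x) (u y) ≤ K * dist x y := by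
    intro x y hx hy
    have hc : Continuous fun s : ℝ => ‖AffineMap.lineMap x y s‖ := by
      exact (AffineMap.lineMap_continuous).norm
    obtain ⟨s, hs, hsR⟩ := intermediate_value_Icc zero_le_one hc.continuousOn
      (⟨by simpa using hx, by simpa using hy.le⟩ : R ∈ Icc _ _)
    set z : V := AffineMap.lineMap x y s
    have hz : ‖z‖ = R := hsR
    have e1 : u y = u z := by
      rw [hucl z hz.le, hvS z hz]; simp [u, hy.le]
    rw [e1, hucl x hx, hucl z hz.le]
    refine (hK.dist_le_mul x (by simpa using hx) z (by simpa using hz.le)).trans ?_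
    gcongr
    rw [dist_left_lineMap, Real.norm_of_nonneg hs.1]
    exact mul_le_of_le_one_left dist_nonneg hs.2
  have hLip : LipschitzWith K u := by
    refine LipschitzWith.of_dist_le_mul fun x y => ?_
    rcases le_or_gt ‖x‖ R with hx | hx <;> rcases le_or_gt ‖y‖ R with hy | hy
    · rw [hucl x hx, hucl y hy]
      exact hK.dist_le_mul x (by simpa using hx) y (by simpa using hy)
    · exact key x y hx hy
    · rw [dist_comm, dist_comm x]; exact key y x hy hx
    · simp only [u, hx.le.not_gt, hy.le.not_gt, if_false, dist_self]; positivity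
  refine milnor_core u (fun x => fderiv ℝ v x) K hLip R hR ?_ ?_ ?_
  · intro x hx; simp [u, hx]
  · intro x hx
    refine ((hv.differentiable one_ne_zero) x).hasFDerivAt.congr_of_eventuallyEq ?_
    filter_upwards [(isOpen_lt continuous_norm continuous_const).mem_nhds hx] with y hy
    have : ‖y‖ < R := hy
    simp [u, this]
  · intro x hx
    simp only [u, hx, if_true, v, add_sub_cancel]
    rw [norm_smul, norm_div, norm_norm, Real.norm_of_nonneg hR.le,
      div_mul_cancel₀ _ (norm_ne_zero_iff.2 (hFt x))]

/-- A continuous self-map of a finite dimensional space that is the identity outside a bounded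
set is onto. -/
theorem brouwer_surj {V : Type*} [NormedAddCommGroup V] [NormedSpace ℝ V]
    [FiniteDimensional ℝ V] (F : V → V) (hF : Continuous F) (R₀ : ℝ)
    (hid : ∀ x, R₀ ≤ ‖x‖ → F x = x) (p : V) : ∃ x, F x = p := by
  let e := toEuclidean (E := V)
  obtain ⟨C, hC⟩ : ∃ C : ℝ, ∀ x, ‖e x‖ ≤ C * ‖x‖ :=
    ⟨‖e.toContinuousLinearMap‖, fun x => e.toContinuousLinearMap.le_opNorm x⟩
  have hR : ∃ R₁ : ℝ, ∀ y, R₁ ≤ ‖y‖ → R₀ ≤ ‖e.symm y + p‖ := by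
    refine ⟨|C| * |R₀| + ‖e p‖ + 1, fun y hy => ?_⟩
    by_contra h
    push Not at h
    have h1 : ‖y‖ ≤ ‖e (e.symm y + p)‖ + ‖e p‖ := by
      calc ‖y‖ = ‖e (e.symm y + p) - e p‖ := by simp
        _ ≤ _ := norm_sub_le _ _
    have h2 := hC (e.symm y + p)
    have h3 : C * ‖e.symm y + p‖ ≤ |C| * |R₀| := by
      refine mul_le_mul (le_abs_self _) (h.le.trans (le_abs_self _)) (norm_nonneg _) (abs_nonneg _)
    linarith
  obtain ⟨R₁, hR₁⟩ := hR
  obtain ⟨y, hy⟩ := brouwer_zero (fun y => e (F (e.symm y + p) - p))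
    (by have := e.continuous; have := e.symm.continuous; fun_prop) R₁
    (fun y hy => by rw [hid _ (hR₁ y hy)]; simp)
  refine ⟨e.symm y + p, ?_⟩
  have : F (e.symm y + p) - p = 0 := e.injective (by simpa using hy)
  exact sub_eq_zero.1 this

end

section
open Set Metric

lemma linking_lemma {X Y : Type*} [NormedAddCommGroup X] [NormedSpace ℝ X]
    [NormedAddCommGroup Y] [NormedSpace ℝ Y] [FiniteDimensional ℝ Y]
    (ι : Y →L[ℝ] X) (P : X →L[ℝ] Y) (e : X) (q : X → ℝ) (hq : Continuous q)
    (hP : ∀ y (s : ℝ), P (ι y + s • e) = y) (hqs : ∀ y (s : ℝ), q (ι y + s • e) = |s|)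
    (φ : X → X) (hφ : Continuous φ) (R α : ℝ) (hα : 0 < α) (hαR : α < R)
    (hb : ∀ y (s : ℝ), ‖y‖ ≤ R → 0 ≤ s → s ≤ R → (‖y‖ = R ∨ s = 0 ∨ s = R) →
      φ (ι y + s • e) = ι y + s • e) :
    ∃ y, ∃ s : ℝ, ‖y‖ ≤ R ∧ 0 ≤ s ∧ s ≤ R ∧ P (φ (ι y + s • e)) = 0 ∧
      q (φ (ι y + s • e)) = α := by
  have hR : 0 < R := hα.trans hαR
  let ρ : Y × ℝ → Y × ℝ := fun z => ((R / max R ‖z.1‖) • z.1, max 0 (min z.2 R))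
  have hm : ∀ y : Y, 0 < max R ‖y‖ := fun y => lt_of_lt_of_le hR (le_max_left _ _)
  have hρc : Continuous ρ := by
    refine Continuous.prodMk (Continuous.smul ?_ continuous_fst) (by fun_prop)
    exact continuous_const.div (by fun_prop) (fun z => (hm _).ne')
  have hρ1 : ∀ z, ‖(ρ z).1‖ ≤ R := by
    intro z
    simp only [ρ]
    rw [norm_smul, Real.norm_of_nonneg (by positivity), div_mul_eq_mul_div, div_le_iff₀ (hm _)]
    gcongr; exact le_max_right _ _
  have hρ2 : ∀ z, 0 ≤ (ρ z).2 ∧ (ρ z).2 ≤ R := fun z =>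
    ⟨le_max_left _ _, max_le hR.le (min_le_right _ _)⟩
  let G : Y × ℝ → Y × ℝ := fun z => (P (φ (ι z.1 + z.2 • e)), q (φ (ι z.1 + z.2 • e)))
  have hGc : Continuous G := by
    have h1 : Continuous fun z : Y × ℝ => φ (ι z.1 + z.2 • e) := hφ.comp (by fun_prop)
    exact (P.continuous.comp h1).prodMk (hq.comp h1)
  let F : Y × ℝ → Y × ℝ := fun z => G (ρ z) + (z - ρ z)
  have hin : ∀ z : Y × ℝ, ‖z.1‖ ≤ R → 0 ≤ z.2 → z.2 ≤ R → ρ z = z := by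
    intro z h1 h2 h3
    simp only [ρ]
    ext1
    · simp [max_eq_left h1, div_self hR.ne']
    · simp [min_eq_left h3, max_eq_right h2]
  have hbd : ∀ z : Y × ℝ, (‖(ρ z).1‖ = R ∨ (ρ z).2 = 0 ∨ (ρ z).2 = R) → F z = z := by
    intro z hz
    have h1 := hb (ρ z).1 (ρ z).2 (hρ1 z) (hρ2 z).1 (hρ2 z).2 hz
    have h2 : G (ρ z) = ρ z := by
      simp only [G, h1, hP, hqs]
      rw [abs_of_nonneg (hρ2 z).1]
    simp [F, h2]
  have hout : ∀ z : Y × ℝ, ¬ (‖z.1‖ ≤ R ∧ 0 ≤ z.2 ∧ z.2 ≤ R) → F z = z := by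
    intro z hz
    apply hbd
    by_cases h1 : ‖z.1‖ ≤ R
    · by_cases h2 : 0 ≤ z.2
      · have h3 : R < z.2 := by
          by_contra h; exact hz ⟨h1, h2, not_lt.1 h⟩
        right; right
        simp [ρ, min_eq_right h3.le, max_eq_right hR.le]
      · right; left
        push Not at h2
        simp [ρ, h2.le]
    · left
      push Not at h1
      have : 0 < ‖z.1‖ := hR.trans h1
      simp only [ρ]
      rw [max_eq_right h1.le, norm_smul, Real.norm_of_nonneg (by positivity),
        div_mul_cancel₀ _ this.ne']
  obtain ⟨z, hz⟩ := brouwer_surj F (by fun_prop) (R + 1) (fun z hz => hout z (by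
    rintro ⟨h1, h2, h3⟩
    have : ‖z‖ ≤ R := by
      rw [Prod.norm_def]
      exact max_le h1 (by rw [Real.norm_of_nonneg h2]; exact h3)
    linarith)) (0, α)
  by_cases hz' : ‖z.1‖ ≤ R ∧ 0 ≤ z.2 ∧ z.2 ≤ R
  · obtain ⟨h1, h2, h3⟩ := hz'
    refine ⟨z.1, z.2, h1, h2, h3, ?_⟩
    simp only [F, hin z h1 h2 h3, sub_self, add_zero, G, Prod.mk.injEq] at hz
    exact hz
  · rw [hout z hz'] at hz
    rw [hz] at hz'
    exact absurd ⟨by simpa using hR.le, hα.le, hαR.le⟩ hz'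

theorem minimax_lemma {X Y : Type*} [NormedAddCommGroup X] [InnerProductSpace ℝ X]
    [NormedAddCommGroup Y] [NormedSpace ℝ Y] [FiniteDimensional ℝ Y]
    (Φ : X → ℝ) (g : X → X) (hΦ : Continuous Φ) (hg : Continuous g) (L : ℝ) (hL : 0 < L)
    (hdesc : ∀ x y, Φ y ≤ Φ x + inner ℝ (g x) (y - x) + L * ‖y - x‖ ^ 2)
    (ι : Y →L[ℝ] X) (P : X →L[ℝ] Y) (e : X) (q : X → ℝ) (hq : Continuous q)
    (hP : ∀ y (s : ℝ), P (ι y + s • e) = y) (hqs : ∀ y (s : ℝ), q (ι y + s • e) = |s|)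
    (R α β : ℝ) (hα : 0 < α) (hαR : α < R) (hβ : 0 < β)
    (hb : ∀ y (s : ℝ), ‖y‖ ≤ R → 0 ≤ s → s ≤ R → (‖y‖ = R ∨ s = 0 ∨ s = R) →
      Φ (ι y + s • e) ≤ 0)
    (hΓ : ∀ x, P x = 0 → q x = α → β ≤ Φ x) (δ : ℝ) (hδ : 0 < δ) :
    ∃ x, β ≤ Φ x ∧ ‖g x‖ < δ := by
  by_contra hcon
  push Not at hcon
  let η : X → ℝ := fun x => min 1 (max 0 (Φ x / β))
  have hη0 : ∀ x, 0 ≤ η x := fun x => le_min zero_le_one (le_max_left _ _)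
  have hη1 : ∀ x, η x ≤ 1 := fun x => min_le_left _ _
  let S : X → X := fun x => x - (1 / (2 * L) * η x) • g x
  have hS : Continuous S := by simp only [S, η]; fun_prop
  have hstep : ∀ x, Φ (S x) ≤ Φ x - η x / (4 * L) * ‖g x‖ ^ 2 := by
    intro x
    have h1 := hdesc x (S x)
    have h2 : S x - x = -((1 / (2 * L) * η x) • g x) := by simp only [S]; abel
    rw [h2, inner_neg_right, inner_smul_right, real_inner_self_eq_norm_sq, norm_neg, norm_smul,
      mul_pow, Real.norm_eq_abs, sq_abs] at h1
    refine h1.trans ?_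
    have h3 : Φ x + -(1 / (2 * L) * η x * ‖g x‖ ^ 2) + L * ((1 / (2 * L) * η x) ^ 2 * ‖g x‖ ^ 2)
      = Φ x - η x / (4 * L) * ‖g x‖ ^ 2 - (η x * (1 - η x)) * (‖g x‖ ^ 2 / (4 * L)) := by
      field_simp; ring
    rw [h3]
    have : 0 ≤ (η x * (1 - η x)) * (‖g x‖ ^ 2 / (4 * L)) :=
      mul_nonneg (mul_nonneg (hη0 x) (sub_nonneg.2 (hη1 x))) (by positivity)
    linarith
  have hmono : ∀ x, Φ (S x) ≤ Φ x := by
    intro x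
    have : 0 ≤ η x / (4 * L) * ‖g x‖ ^ 2 :=
      mul_nonneg (div_nonneg (hη0 x) (by positivity)) (by positivity)
    linarith [hstep x]
  have hfix : ∀ x, Φ x ≤ 0 → S x = x := by
    intro x hx
    have : Φ x / β ≤ 0 := div_nonpos_of_nonpos_of_nonneg hx hβ.le
    simp [S, η, this]
  set c := δ ^ 2 / (4 * L) with hc
  have hcpos : 0 < c := by positivity
  have hdrop : ∀ x, β ≤ Φ x → Φ (S x) ≤ Φ x - c := by
    intro x hx
    have h1 : η x = 1 := by
      have : 1 ≤ Φ x / β := (one_le_div hβ).2 hx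
      simp only [η]
      rw [max_eq_right (by linarith), min_eq_left this]
    have h2 := hstep x
    rw [h1] at h2
    have h3 : c ≤ 1 / (4 * L) * ‖g x‖ ^ 2 := by
      rw [hc, div_mul_eq_mul_div, one_mul]
      have := hcon x hx
      gcongr
    linarith
  have hiter : ∀ (k : ℕ) x, Φ (S^[k] x) < β ∨ Φ (S^[k] x) ≤ Φ x - k * c := by
    intro k x
    induction k with
    | zero => right; simp
    | succ k ih =>
      rw [Function.iterate_succ_apply']
      rcases ih with h | h
      · left; exact lt_of_le_of_lt (hmono _) h
      · by_cases h' : β ≤ Φ (S^[k] x)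
        · right
          have := hdrop _ h'
          push_cast; linarith
        · left; exact lt_of_le_of_lt (hmono _) (not_le.1 h')
  obtain ⟨M, hM⟩ : ∃ M, ∀ y (s : ℝ), ‖y‖ ≤ R → 0 ≤ s → s ≤ R → Φ (ι y + s • e) ≤ M := by
    have hcomp : IsCompact ((closedBall (0:Y) R) ×ˢ (Icc (0:ℝ) R)) :=
      (isCompact_closedBall _ _).prod isCompact_Icc
    obtain ⟨M, hM⟩ := hcomp.bddAbove_image
      (f := fun z : Y × ℝ => Φ (ι z.1 + z.2 • e)) (by fun_prop)
    refine ⟨M, fun y s h1 h2 h3 => hM ⟨(y, s), ⟨by simpa using h1, h2, h3⟩, rfl⟩⟩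
  obtain ⟨k, hk⟩ := exists_nat_gt ((M - β) / c)
  rw [div_lt_iff₀ hcpos] at hk
  obtain ⟨y, s, h1, h2, h3, h4, h5⟩ := linking_lemma ι P e q hq hP hqs (S^[k]) (hS.iterate k) R α
    hα hαR (fun y s h1 h2 h3 h4 => Function.iterate_fixed (hfix _ (hb y s h1 h2 h3 h4)) k)
  have h6 := hΓ _ h4 h5
  rcases hiter k (ι y + s • e) with h | h
  · linarith
  · linarith [hM y s h1 h2 h3]

end

section
open MeasureTheory AddCircle

lemma inner_real_eq_re {n : ℕ} (x y : Esp n) : inner ℝ x y = (inner ℂ x y).re := by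
  simp [PiLp.inner_apply]

lemma inner_smul_adj {n : ℕ} (c : ℂ) (x y : Esp n) :
    inner ℝ (c • x) y = inner ℝ x ((starRingEnd ℂ) c • y) := by
  rw [inner_real_eq_re, inner_real_eq_re, inner_smul_left, inner_smul_right]

/-- Coefficient space of trigonometric polynomials with frequencies in `s`. -/
abbrev XX (n : ℕ) (s : Finset ℤ) := PiLp 2 (fun _ : s => Esp n)

/-- Evaluation of a trigonometric polynomial. -/
def ev {n : ℕ} {s : Finset ℤ} (x : XX n s) (t : UnitAddCircle) : Esp n :=
  ∑ k : s, (fourier (k : ℤ) t : ℂ) • x k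

/-- Truncated Fourier coefficients of a loop. -/
def coefs {n : ℕ} (s : Finset ℤ) (f : UnitAddCircle → Esp n) : XX n s :=
  WithLp.toLp 2 (fun k : s => fourierCoeff f (k : ℤ))

variable {s : Finset ℤ}

lemma ev_add (x y : XX n s) (t) : ev (x + y) t = ev x t + ev y t := by
  simp [ev, smul_add, Finset.sum_add_distrib]

lemma ev_sub (x y : XX n s) (t) : ev (x - y) t = ev x t - ev y t := by
  simp [ev, smul_sub, Finset.sum_sub_distrib]

lemma ev_cont2 : Continuous fun p : XX n s × UnitAddCircle => ev p.1 p.2 := by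
  unfold ev
  refine continuous_finsetSum _ fun k _ => ?_
  refine Continuous.smul ((fourier (k:ℤ)).continuous.comp continuous_snd) ?_
  fun_prop

lemma ev_cont (x : XX n s) : Continuous (ev x) := by
  unfold ev
  refine continuous_finsetSum _ fun k _ => ?_
  exact (fourier (k:ℤ)).continuous.smul continuous_const

lemma int_of_cont {F : Type*} [NormedAddCommGroup F] {f : UnitAddCircle → F}
    (hf : Continuous f) : Integrable f haarAddCircle := by
  rw [← integrableOn_univ]
  exact hf.continuousOn.integrableOn_compact isCompact_univ

lemma coefs_inner (f : UnitAddCircle → Esp n) (hf : Continuous f) (x : XX n s) :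
    inner ℝ (coefs s f) x = ∫ t, inner ℝ (f t) (ev x t) ∂haarAddCircle := by
  have h1 : ∀ k : s, inner ℝ (fourierCoeff f (k:ℤ)) (x k)
      = ∫ t, inner ℝ (f t) ((fourier (k:ℤ) t : ℂ) • x k) ∂haarAddCircle := by
    intro k
    have hc : Continuous fun t => (fourier (-(k:ℤ)) t : ℂ) • f t :=
      (fourier (-(k:ℤ))).continuous.smul hf
    rw [fourierCoeff, real_inner_comm, ← integral_inner (int_of_cont hc)]
    refine integral_congr_ae (Filter.Eventually.of_forall fun t => ?_)
    simp only
    rw [real_inner_comm, inner_smul_adj, fourier_neg, Complex.conj_conj]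
  rw [PiLp.inner_apply]
  simp only [coefs, ev, inner_sum]
  rw [integral_finsetSum]
  · exact Finset.sum_congr rfl fun k _ => h1 k
  · intro k _
    apply int_of_cont
    exact hf.inner ((fourier (k:ℤ)).continuous.smul continuous_const)

lemma fourierCoeff_ev (x : XX n s) (j : ℤ) (hj : j ∈ s) : fourierCoeff (ev x) j = x ⟨j, hj⟩ := by
  have h1 : ∀ k : s, ∫ t : UnitAddCircle, (fourier (-j) t : ℂ) • ((fourier (k:ℤ) t : ℂ) • x k) ∂haarAddCircle
      = (if (k:ℤ) = j then (1:ℂ) else 0) • x k := by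
    intro k
    simp_rw [smul_smul]
    rw [integral_smul_const]
    congr 1
    have := congrFun (fourierCoeff_fourier (T := 1) (k:ℤ)) j
    rw [fourierCoeff] at this
    simp only [smul_eq_mul] at this
    rw [this, Pi.single_apply]
    simp [eq_comm]
  rw [fourierCoeff]
  simp only [ev, Finset.smul_sum]
  rw [integral_finsetSum]
  · simp_rw [h1]
    rw [Finset.sum_eq_single ⟨j, hj⟩]
    · simp
    · intro b _ hb
      have : (b:ℤ) ≠ j := fun h => hb (Subtype.ext h)
      simp [this]
    · simp
  · intro k _
    apply int_of_cont
    exact (fourier (-j)).continuous.smul ((fourier (k:ℤ)).continuous.smul continuous_const)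

lemma coefs_ev (x : XX n s) : coefs s (ev x) = x := by
  ext k : 1
  exact fourierCoeff_ev x k k.2

lemma inner_eq_int (x y : XX n s) :
    inner ℝ x y = ∫ t, inner ℝ (ev x t) (ev y t) ∂haarAddCircle := by
  rw [← coefs_inner _ (ev_cont x), coefs_ev]

lemma normsq_eq_int (x : XX n s) : ‖x‖ ^ 2 = ∫ t, ‖ev x t‖ ^ 2 ∂haarAddCircle := by
  rw [← real_inner_self_eq_norm_sq, inner_eq_int]
  simp_rw [real_inner_self_eq_norm_sq]

/-- The truncated action functional. -/
def Phi (Gb : Esp n → ℝ) (x : XX n s) : ℝ :=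
  Real.pi * ∑ k : s, ((k : ℤ) : ℝ) * ‖x k‖ ^ 2 - ∫ t, Gb (ev x t) ∂haarAddCircle

/-- Its gradient. -/
def gradPhi (W : Esp n → Esp n) (x : XX n s) : XX n s :=
  WithLp.toLp 2 (fun k : s => (2 * Real.pi * ((k : ℤ) : ℝ)) • x k - fourierCoeff (fun t => W (ev x t)) (k : ℤ))

lemma cont_param {F : Type*} [NormedAddCommGroup F] [NormedSpace ℝ F] {f : XX n s → UnitAddCircle → F}
    (hf : Continuous (Function.uncurry f)) : Continuous fun x => ∫ t, f x t ∂haarAddCircle := by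
  have := continuous_parametric_integral_of_continuous (μ := haarAddCircle (T := 1)) hf isCompact_univ
  simpa using this

lemma Phi_cont (Gb : Esp n → ℝ) (hG : Continuous Gb) : Continuous (Phi (s := s) Gb) := by
  unfold Phi
  refine Continuous.sub (by fun_prop) (cont_param ?_)
  exact hG.comp ev_cont2

lemma gradPhi_cont (W : Esp n → Esp n) (hW : Continuous W) : Continuous (gradPhi (s := s) W) := by
  unfold gradPhi
  refine (PiLp.continuous_toLp 2 _).comp (continuous_pi fun k => ?_)
  refine Continuous.sub (by fun_prop) ?_
  unfold fourierCoeff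
  refine cont_param ?_
  refine Continuous.smul ((fourier (-(k:ℤ))).continuous.comp continuous_snd) ?_
  exact hW.comp ev_cont2

lemma Phi_desc (Gb : Esp n → ℝ) (hG : Continuous Gb) (W : Esp n → Esp n) (hW : Continuous W) (L : ℝ)
    (hq : ∀ x y, Gb x + inner ℝ (W x) (y - x) - L * ‖y - x‖ ^ 2 ≤ Gb y) (N : ℝ)
    (hN : ∀ k ∈ s, (k : ℝ) ≤ N) (x y : XX n s) :
    Phi Gb y ≤ Phi Gb x + inner ℝ (gradPhi W x) (y - x) + (Real.pi * N + L) * ‖y - x‖ ^ 2 := by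
  have hWc : Continuous fun t => W (ev x t) := hW.comp (ev_cont x)
  have h1 : gradPhi W x = WithLp.toLp 2 (fun k : s => (2 * Real.pi * ((k : ℤ) : ℝ)) • x k)
      - coefs s (fun t => W (ev x t)) := by
    ext k : 1
    simp [gradPhi, coefs]
  rw [h1, inner_sub_left, coefs_inner _ hWc, PiLp.inner_apply]
  simp only [ev_sub, PiLp.sub_apply, inner_smul_left]
  have h2 : ∫ t, (Gb (ev x t) + inner ℝ (W (ev x t)) (ev y t - ev x t) - L * ‖ev (y - x) t‖ ^ 2) ∂haarAddCircle
      ≤ ∫ t, Gb (ev y t) ∂haarAddCircle := by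
    refine integral_mono (int_of_cont ?_) (int_of_cont (hG.comp (ev_cont y))) (fun t => ?_)
    · have := ev_cont x
      have := ev_cont y
      have := ev_cont (y - x)
      fun_prop
    · simp only [ev_sub]
      exact hq _ _
  rw [integral_sub, integral_add, integral_const_mul, ← normsq_eq_int] at h2
  rotate_left
  · exact int_of_cont (hG.comp (ev_cont x))
  · exact int_of_cont (hWc.inner ((ev_cont y).sub (ev_cont x)))
  · refine int_of_cont ((hG.comp (ev_cont x)).add (hWc.inner ((ev_cont y).sub (ev_cont x))))
  · exact int_of_cont ((continuous_const).mul ((ev_cont _).norm.pow 2))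
  have h3 : Real.pi * ∑ k : s, ((k:ℤ):ℝ) * ‖y k‖ ^ 2 ≤ Real.pi * ∑ k : s, ((k:ℤ):ℝ) * ‖x k‖ ^ 2
      + ∑ k : s, (2 * Real.pi * ((k : ℤ) : ℝ)) * inner ℝ (x k) (y k - x k)
      + Real.pi * N * ‖y - x‖ ^ 2 := by
    rw [PiLp.norm_sq_eq_of_L2, Finset.mul_sum, Finset.mul_sum, Finset.mul_sum,
      ← Finset.sum_add_distrib, ← Finset.sum_add_distrib]
    refine Finset.sum_le_sum fun k _ => ?_
    have e1 : ‖y k‖ ^ 2 = ‖x k‖ ^ 2 + 2 * inner ℝ (x k) (y k - x k) + ‖y k - x k‖ ^ 2 := by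
      rw [← norm_add_sq_real]; simp
    rw [e1, PiLp.sub_apply]
    have := mul_le_mul_of_nonneg_left (mul_le_mul_of_nonneg_right (hN k k.2) (sq_nonneg ‖y k - x k‖)) Real.pi_pos.le
    nlinarith
  unfold Phi
  simp only [conj_trivial]
  linarith

end

section
open MeasureTheory AddCircle

/-- Standing assumptions on the modified Hamiltonian `Gb` with gradient `W`. -/
structure Adm {n : ℕ} (Gb : Esp n → ℝ) (W : Esp n → Esp n) (L C lam δ : ℝ) : Prop where
  contG : Continuous Gb
  contW : Continuous W
  hL : 0 ≤ L
  hC : 0 ≤ C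
  quad : ∀ x y, Gb x + inner ℝ (W x) (y - x) - L * ‖y - x‖ ^ 2 ≤ Gb y
  nonneg : ∀ x, 0 ≤ Gb x
  hδ : 0 < δ
  zero : ∀ x, ‖x‖ ≤ δ → Gb x = 0
  up : ∀ x, Gb x ≤ C * ‖x‖ ^ 2
  hlam : Real.pi < lam
  low : ∀ x, lam * ‖x‖ ^ 2 - C ≤ Gb x

variable {s : Finset ℤ}

/-- The coefficients with nonpositive index. -/
def negSub (n : ℕ) (s : Finset ℤ) : Submodule ℝ (XX n s) where
  carrier := {x | ∀ k : s, 0 < (k:ℤ) → x k = 0}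
  add_mem' := by
    intro a b ha hb k hk
    simp [ha k hk, hb k hk]
  zero_mem' := by intro k _; simp
  smul_mem' := by
    intro c a ha k hk
    simp [ha k hk]

/-- Restriction of coefficients to an index set. -/
def cut (p : ℤ → Prop) [DecidablePred p] (x : XX n s) : XX n s :=
  WithLp.toLp 2 (fun k : s => if p (k:ℤ) then x k else 0)

def negProj (n : ℕ) (s : Finset ℤ) : XX n s →L[ℝ] negSub n s :=
  LinearMap.toContinuousLinearMap (LinearMap.codRestrict (negSub n s)
    { toFun := fun x => cut (fun k => k ≤ 0) x
      map_add' := by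
        intro x y; ext k : 1; simp only [cut, PiLp.add_apply]; split_ifs <;> simp
      map_smul' := by
        intro c x; ext k : 1; simp only [cut, PiLp.smul_apply]; split_ifs <;> simp }
    (by intro x k hk
        simp [cut, hk]))

lemma negProj_apply (x : XX n s) (k : s) :
    ((negProj n s x : negSub n s) : XX n s) k = if (k:ℤ) ≤ 0 then x k else 0 := rfl

def qPlus (x : XX n s) : ℝ := Real.sqrt (∑ k : s, max ((k:ℤ):ℝ) 0 * ‖x k‖ ^ 2)

lemma qPlus_cont : Continuous (qPlus : XX n s → ℝ) := by
  unfold qPlus; fun_prop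

lemma cut_add (p : ℤ → Prop) [DecidablePred p] (x : XX n s) :
    x = cut p x + cut (fun k => ¬ p k) x := by
  ext k : 1
  simp only [cut, PiLp.add_apply]
  by_cases h : p (k:ℤ) <;> simp [h]

lemma lower_gamma {Gb : Esp n → ℝ} {W : Esp n → Esp n} {L C lam δ : ℝ} (h : Adm Gb W L C lam δ)
    (K : ℕ) (hK : 0 < K) (hKC : 8 * C ≤ Real.pi * K) (α : ℝ) (hα : 0 < α) (hKα : K * α ≤ δ / 2)
    (x : XX n s) (hx0 : ∀ k : s, (k:ℤ) ≤ 0 → x k = 0)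
    (hxα : ∑ k : s, ((k:ℤ):ℝ) * ‖x k‖ ^ 2 = α ^ 2) :
    Real.pi / 2 * α ^ 2 ≤ Phi Gb x := by
  have hnn : ∀ k : s, 0 ≤ ((k:ℤ):ℝ) * ‖x k‖ ^ 2 := by
    intro k
    rcases le_or_gt (k:ℤ) 0 with hk | hk
    · simp [hx0 k hk]
    · have : (0:ℝ) < ((k:ℤ):ℝ) := by exact_mod_cast hk
      positivity
  have hxk : ∀ k : s, ‖x k‖ ≤ α := by
    intro k
    rcases le_or_gt (k:ℤ) 0 with hk | hk
    · simp [hx0 k hk, hα.le]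
    · have h1 : ((k:ℤ):ℝ) * ‖x k‖ ^ 2 ≤ α ^ 2 := by
        rw [← hxα]
        exact Finset.single_le_sum (f := fun k : s => ((k:ℤ):ℝ) * ‖x k‖ ^ 2) (fun i _ => hnn i) (Finset.mem_univ k)
      have h2 : (1:ℝ) ≤ ((k:ℤ):ℝ) := by exact_mod_cast hk
      have h3 : ‖x k‖ ^ 2 ≤ α ^ 2 := by nlinarith [sq_nonneg ‖x k‖]
      exact (sq_le_sq₀ (norm_nonneg _) hα.le).1 h3
  set u : XX n s := cut (fun k => k ≤ K) x with hu
  set v : XX n s := cut (fun k => ¬ k ≤ K) x with hv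
  have huv : x = u + v := cut_add _ x
  have hub : ∀ t, ‖ev u t‖ ≤ δ / 2 := by
    intro t
    refine le_trans ?_ hKα
    unfold ev
    refine (norm_sum_le _ _).trans ?_
    have h1 : ∀ k : s, ‖(fourier (k:ℤ) t : ℂ) • u k‖ ≤ if (k:ℤ) ∈ Finset.Icc (1:ℤ) K then α else 0 := by
      intro k
      rw [norm_smul]
      have hf : ‖(fourier (k:ℤ) t : ℂ)‖ = 1 := by
        rw [fourier_apply]; exact Circle.norm_coe _
      rw [hf, one_mul]
      simp only [hu, cut]
      by_cases hk : (k:ℤ) ≤ K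
      · rw [if_pos hk]
        by_cases hk' : (k:ℤ) ≤ 0
        · rw [hx0 k hk', norm_zero]; split_ifs <;> simp [hα.le]
        · rw [if_pos (Finset.mem_Icc.2 ⟨by omega, hk⟩)]; exact hxk k
      · rw [if_neg hk, norm_zero]; split_ifs <;> simp [hα.le]
    refine (Finset.sum_le_sum fun k _ => h1 k).trans ?_
    rw [Finset.sum_coe_sort s (fun k => if k ∈ Finset.Icc (1:ℤ) K then α else 0), ← Finset.sum_filter,
      Finset.sum_const, nsmul_eq_mul]
    gcongr
    have : (s.filter (fun k => k ∈ Finset.Icc (1:ℤ) K)).card ≤ (Finset.Icc (1:ℤ) K).card :=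
      Finset.card_le_card (fun k hk => (Finset.mem_filter.1 hk).2)
    simpa using this
  have hvb : K * ‖v‖ ^ 2 ≤ α ^ 2 := by
    rw [← hxα, PiLp.norm_sq_eq_of_L2, Finset.mul_sum]
    refine Finset.sum_le_sum fun k _ => ?_
    simp only [hv, cut]
    by_cases hk : (k:ℤ) ≤ K
    · simp only [hk, not_true, if_false, norm_zero]; simpa using hnn k
    · simp only [hk, not_false_iff, if_true]
      have : (K:ℝ) ≤ ((k:ℤ):ℝ) := by exact_mod_cast (not_le.1 hk).le
      gcongr
  have hpt : ∀ t, Gb (ev x t) ≤ 4 * C * ‖ev v t‖ ^ 2 := by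
    intro t
    have hC := h.hC
    by_cases hs : ‖ev x t‖ ≤ δ
    · rw [h.zero _ hs]; positivity
    · push Not at hs
      have h1 : ‖ev x t‖ ≤ ‖ev u t‖ + ‖ev v t‖ := by
        rw [huv, ev_add]; exact norm_add_le _ _
      have h2 := hub t
      have h3 : ‖ev x t‖ ≤ 2 * ‖ev v t‖ := by linarith
      refine (h.up _).trans ?_
      have h4 : ‖ev x t‖ ^ 2 ≤ (2 * ‖ev v t‖) ^ 2 := by gcongr
      nlinarith
  have hinteg : ∫ t, Gb (ev x t) ∂haarAddCircle ≤ 4 * C * ‖v‖ ^ 2 := by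
    rw [normsq_eq_int, ← integral_const_mul]
    refine integral_mono (int_of_cont (h.contG.comp (ev_cont x))) (int_of_cont ?_) hpt
    exact continuous_const.mul ((ev_cont v).norm.pow 2)
  unfold Phi
  rw [hxα]
  have : 8 * C * ‖v‖ ^ 2 ≤ Real.pi * K * ‖v‖ ^ 2 := by gcongr
  nlinarith [Real.pi_pos]

lemma upper_sigma {Gb : Esp n → ℝ} {W : Esp n → Esp n} {L C lam δ : ℝ} (h : Adm Gb W L C lam δ)
    (x : XX n s) (hx : ∀ k : s, 1 < (k:ℤ) → x k = 0) :
    Phi Gb x ≤ C - (lam - Real.pi) * ‖x‖ ^ 2 := by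
  have h1 : ∑ k : s, ((k:ℤ):ℝ) * ‖x k‖ ^ 2 ≤ ‖x‖ ^ 2 := by
    rw [PiLp.norm_sq_eq_of_L2]
    refine Finset.sum_le_sum fun k _ => ?_
    by_cases hk : 1 < (k:ℤ)
    · simp [hx k hk]
    · have : ((k:ℤ):ℝ) ≤ 1 := by exact_mod_cast not_lt.1 hk
      nlinarith [sq_nonneg ‖x k‖]
  have h2 : lam * ‖x‖ ^ 2 - C ≤ ∫ t, Gb (ev x t) ∂haarAddCircle := by
    have e : lam * ‖x‖ ^ 2 - C = ∫ t, (lam * ‖ev x t‖ ^ 2 - C) ∂haarAddCircle := by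
      rw [integral_sub, integral_const_mul, ← normsq_eq_int]
      · simp
      · exact int_of_cont (continuous_const.mul ((ev_cont x).norm.pow 2))
      · exact int_of_cont continuous_const
    rw [e]
    refine integral_mono (int_of_cont ?_) (int_of_cont (h.contG.comp (ev_cont x))) (fun t => h.low _)
    exact (continuous_const.mul ((ev_cont x).norm.pow 2)).sub continuous_const
  unfold Phi
  nlinarith [Real.pi_pos]

theorem galerkin {Gb : Esp n → ℝ} {W : Esp n → Esp n} {L C lam δ : ℝ} (hn : 1 ≤ n)
    (h : Adm Gb W L C lam δ) :
    ∃ β > 0, ∀ s : Finset ℤ, 1 ∈ s → ∀ ε > 0, ∃ x : XX n s, β ≤ Phi Gb x ∧ ‖gradPhi W x‖ < ε := by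
  obtain ⟨K₀, hK₀⟩ := exists_nat_ge (8 * C / Real.pi)
  set K := K₀ + 1
  have hKC : 8 * C ≤ Real.pi * K := by
    rw [div_le_iff₀ Real.pi_pos] at hK₀
    have := Real.pi_pos
    simp only [K]; push_cast; nlinarith
  have hK : 0 < K := Nat.succ_pos _
  have hKr : (0:ℝ) < K := by exact_mod_cast hK
  set α := δ / 2 / K
  have hα : 0 < α := by have := h.hδ; positivity
  have hKα : K * α ≤ δ / 2 := by
    simp only [α]; rw [mul_div_cancel₀ _ hKr.ne']
  refine ⟨Real.pi / 2 * α ^ 2, by have := Real.pi_pos; positivity, fun s hs ε hε => ?_⟩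
  set e : XX n s := WithLp.toLp 2 (Pi.single (⟨1, hs⟩ : s) (EuclideanSpace.single (⟨0, hn⟩ : Fin n) (1:ℂ))) with he
  have hek : ∀ k : s, (k:ℤ) ≠ 1 → e k = 0 := by
    intro k hk
    have : k ≠ ⟨1, hs⟩ := fun h => hk (by rw [h])
    simp [he, this]
  have he1 : ‖e ⟨1, hs⟩‖ = 1 := by simp [he]
  obtain ⟨N, hN0, hN⟩ : ∃ N : ℝ, 0 ≤ N ∧ ∀ k ∈ s, (k:ℝ) ≤ N := by
    refine ⟨∑ k ∈ s, |(k:ℝ)|, by positivity, fun k hk => ?_⟩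
    exact (le_abs_self _).trans (Finset.single_le_sum (f := fun k : ℤ => |(k:ℝ)|) (fun i _ => abs_nonneg _) hk)
  set R : ℝ := α + C / (lam - Real.pi) + 1
  have hlam : 0 < lam - Real.pi := sub_pos.2 h.hlam
  have hCl : 0 ≤ C / (lam - Real.pi) := div_nonneg h.hC hlam.le
  have hRα : α < R := by simp only [R]; linarith
  have hRC : C ≤ (lam - Real.pi) * R ^ 2 := by
    have h1 : C / (lam - Real.pi) ≤ R := by simp only [R]; linarith
    have h2 : 1 ≤ R := by simp only [R]; linarith
    rw [div_le_iff₀ hlam] at h1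
    have h3 : R ≤ R ^ 2 := by nlinarith
    have h4 := mul_le_mul_of_nonneg_right h3 hlam.le
    linarith
  have hLp : 0 < Real.pi * N + L + 1 := by
    have := h.hL; have := Real.pi_pos; positivity
  have hyk : ∀ (y : negSub n s) (k : s), 0 < (k:ℤ) → (y : XX n s) k = 0 := fun y k hk => y.2 k hk
  refine minimax_lemma (Phi Gb) (gradPhi W) (Phi_cont Gb h.contG) (gradPhi_cont W h.contW)
    (Real.pi * N + L + 1) hLp ?_ (negSub n s).subtypeL (negProj n s) e qPlus qPlus_cont ?_ ?_ R α _ hα hRα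
    (by have := Real.pi_pos; positivity) ?_ ?_ ε hε
  · intro x y
    have := Phi_desc Gb h.contG W h.contW L h.quad N hN x y
    nlinarith [sq_nonneg ‖y - x‖]
  · intro y c
    ext k : 2
    rw [negProj_apply]
    split_ifs with hk
    · simp [hek k (by omega)]
    · rw [hyk y k (by omega)]
  · intro y c
    unfold qPlus
    rw [Finset.sum_eq_single ⟨1, hs⟩]
    · simp only [Submodule.subtypeL_apply, PiLp.add_apply, PiLp.smul_apply]
      rw [hyk y ⟨1, hs⟩ one_pos, zero_add, norm_smul, he1]
      simp [Real.sqrt_sq_eq_abs]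
    · intro k _ hk
      have hk1 : (k:ℤ) ≠ 1 := fun h => hk (Subtype.ext h)
      by_cases hk0 : 0 < (k:ℤ)
      · simp [hyk y k hk0, hek k hk1]
      · have : max ((k:ℤ):ℝ) 0 = 0 := max_eq_right (by exact_mod_cast not_lt.1 hk0)
        rw [this, zero_mul]
    · simp
  · intro y c h1 h2 h3 h4
    set x : XX n s := (negSub n s).subtypeL y + c • e with hx
    have hxk : ∀ k, x k = (y : XX n s) k + c • e k := fun k => rfl
    rcases h4 with h4 | h4 | h4
    · have hle : ‖y‖ ≤ ‖x‖ := by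
        rw [← sq_le_sq₀ (norm_nonneg _) (norm_nonneg _), ← Submodule.norm_coe, PiLp.norm_sq_eq_of_L2, PiLp.norm_sq_eq_of_L2]
        refine Finset.sum_le_sum fun k _ => ?_
        rw [hxk]
        by_cases hk0 : 0 < (k:ℤ)
        · rw [hyk y k hk0]; simp
        · rw [hek k (by omega)]; simp
      have := upper_sigma h x (fun k hk => by rw [hxk, hyk y k (by omega), hek k (by omega)]; simp)
      have h5 : R ^ 2 ≤ ‖x‖ ^ 2 := by rw [← h4]; gcongr
      nlinarith
    · have h6 : ∑ k : s, ((k:ℤ):ℝ) * ‖x k‖ ^ 2 ≤ 0 := by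
        refine Finset.sum_nonpos fun k _ => ?_
        rw [hxk, h4, zero_smul, add_zero]
        by_cases hk0 : 0 < (k:ℤ)
        · simp [hyk y k hk0]
        · have : ((k:ℤ):ℝ) ≤ 0 := by exact_mod_cast not_lt.1 hk0
          exact mul_nonpos_of_nonpos_of_nonneg this (by positivity)
      have h7 : 0 ≤ ∫ t, Gb (ev x t) ∂haarAddCircle := integral_nonneg fun t => h.nonneg _
      unfold Phi
      nlinarith [Real.pi_pos]
    · have hle : R ≤ ‖x‖ := by
        have h8 : ‖x ⟨1, hs⟩‖ ≤ ‖x‖ := PiLp.norm_apply_le x _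
        rw [hxk, hyk y _ one_pos, zero_add, norm_smul, he1, mul_one, Real.norm_of_nonneg h2, h4] at h8
        exact h8
      have := upper_sigma h x (fun k hk => by rw [hxk, hyk y k (by omega), hek k (by omega)]; simp)
      have h5 : R ^ 2 ≤ ‖x‖ ^ 2 := by gcongr
      nlinarith
  · intro x hPx hqx
    have hx0 : ∀ k : s, (k:ℤ) ≤ 0 → x k = 0 := by
      intro k hk
      have := negProj_apply x k
      rw [if_pos hk, hPx] at this
      rw [← this]; rfl
    refine lower_gamma h K hK hKC α hα hKα x hx0 ?_
    unfold qPlus at hqx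
    rw [← hqx, Real.sq_sqrt (Finset.sum_nonneg fun k _ => by positivity)]
    refine Finset.sum_congr rfl fun k _ => ?_
    rcases le_or_gt (k:ℤ) 0 with hk | hk
    · simp [hx0 k hk]
    · rw [max_eq_left (by exact_mod_cast hk.le)]

end

section
open MeasureTheory AddCircle Filter

lemma norm_fourier_one (k : ℤ) (t : UnitAddCircle) : ‖(fourier k t : ℂ)‖ = 1 := by
  rw [fourier_apply]; exact Circle.norm_coe _

lemma summable_weight : Summable fun k : ℤ => 1 / (1 + (k:ℝ) ^ 2) := by
  have h := (Real.summable_one_div_int_add_rpow (1/2) 2).2 (by norm_num)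
  refine Summable.of_nonneg_of_le (fun k => by positivity) (fun k => ?_) (h.mul_left 2)
  have h1 : (|(k:ℝ) + 1/2|) ^ (2:ℝ) = ((k:ℝ) + 1/2) ^ 2 := by
    rw [Real.rpow_two, sq_abs]
  rw [h1]
  have h2 : (k:ℝ) + 1/2 ≠ 0 := by
    intro h
    have h3 : (2 * k + 1 : ℤ) = 0 := by
      have : ((2 * k + 1 : ℤ) : ℝ) = 0 := by push_cast; linarith
      exact_mod_cast this
    omega
  have h3 : 0 < ((k:ℝ) + 1/2) ^ 2 := by positivity
  rw [mul_one_div, div_le_div_iff₀ (by positivity) h3]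
  nlinarith [sq_nonneg ((k:ℝ) - 1/2)]

/-- Modulus of continuity. -/
def modl (t u : UnitAddCircle) : ℝ := ∑' k : ℤ, ‖(fourier k t : ℂ) - fourier k u‖ ^ 2 * (1 / (1 + (k:ℝ) ^ 2))

lemma modl_bound (k : ℤ) (t u : UnitAddCircle) :
    ‖(fourier k t : ℂ) - fourier k u‖ ^ 2 * (1 / (1 + (k:ℝ) ^ 2)) ≤ 4 * (1 / (1 + (k:ℝ) ^ 2)) := by
  refine mul_le_mul_of_nonneg_right ?_ (by positivity)
  have h := norm_sub_le (fourier k t : ℂ) (fourier k u)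
  rw [norm_fourier_one, norm_fourier_one] at h
  nlinarith [norm_nonneg ((fourier k t : ℂ) - fourier k u)]

lemma modl_summable (t u : UnitAddCircle) :
    Summable fun k : ℤ => ‖(fourier k t : ℂ) - fourier k u‖ ^ 2 * (1 / (1 + (k:ℝ) ^ 2)) :=
  Summable.of_nonneg_of_le (fun k => by positivity) (fun k => modl_bound k t u) (summable_weight.mul_left 4)

lemma modl_cont (t : UnitAddCircle) : Continuous (modl t) := by
  refine continuous_tsum (u := fun k : ℤ => 4 * (1 / (1 + (k:ℝ) ^ 2))) (fun k => ?_) (summable_weight.mul_left 4) (fun k u => ?_)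
  · have := (fourier (T := 1) k).continuous
    fun_prop
  · rw [Real.norm_of_nonneg (by positivity)]
    exact modl_bound k t u

lemma modl_self (t : UnitAddCircle) : modl t t = 0 := by simp [modl]

variable {s : Finset ℤ}

lemma cs_bound (x : XX n s) (M : ℝ) (hM : ∑ k : s, (1 + ((k:ℤ):ℝ) ^ 2) * ‖x k‖ ^ 2 ≤ M ^ 2) (hM0 : 0 ≤ M)
    (a : ℤ → ℂ) (ha : Summable fun k : ℤ => ‖a k‖ ^ 2 * (1 / (1 + (k:ℝ) ^ 2))) :
    ‖∑ k : s, a k • x k‖ ≤ Real.sqrt (∑' k : ℤ, ‖a k‖ ^ 2 * (1 / (1 + (k:ℝ) ^ 2))) * M := by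
  have h1 : ‖∑ k : s, a k • x k‖ ≤ ∑ k : s, (‖a k‖ / Real.sqrt (1 + ((k:ℤ):ℝ) ^ 2)) * (Real.sqrt (1 + ((k:ℤ):ℝ) ^ 2) * ‖x k‖) := by
    refine (norm_sum_le _ _).trans (Finset.sum_le_sum fun k _ => ?_)
    rw [norm_smul]
    have : 0 < Real.sqrt (1 + ((k:ℤ):ℝ) ^ 2) := Real.sqrt_pos.2 (by positivity)
    apply le_of_eq
    field_simp
  refine h1.trans ((Real.sum_mul_le_sqrt_mul_sqrt _ _ _).trans ?_)
  refine mul_le_mul (Real.sqrt_le_sqrt ?_) (Real.sqrt_le_iff.2 ⟨hM0, ?_⟩) (Real.sqrt_nonneg _) (Real.sqrt_nonneg _)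
  · have h2 : ∀ k : s, (‖a k‖ / Real.sqrt (1 + ((k:ℤ):ℝ) ^ 2)) ^ 2 = ‖a k‖ ^ 2 * (1 / (1 + ((k:ℤ):ℝ) ^ 2)) := by
      intro k
      rw [div_pow, Real.sq_sqrt (by positivity), mul_one_div]
    simp_rw [h2]
    rw [Finset.sum_coe_sort s (fun k : ℤ => ‖a k‖ ^ 2 * (1 / (1 + (k:ℝ) ^ 2)))]
    exact ha.sum_le_tsum s (fun k _ => by positivity)
  · refine le_trans (le_of_eq ?_) hM
    refine Finset.sum_congr rfl fun k _ => ?_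
    rw [mul_pow, Real.sq_sqrt (by positivity)]

lemma ev_modl (x : XX n s) (M : ℝ) (hM : ∑ k : s, (1 + ((k:ℤ):ℝ) ^ 2) * ‖x k‖ ^ 2 ≤ M ^ 2) (hM0 : 0 ≤ M)
    (t u : UnitAddCircle) : ‖ev x t - ev x u‖ ≤ Real.sqrt (modl t u) * M := by
  have := cs_bound x M hM hM0 (fun k => (fourier k t : ℂ) - fourier k u) (modl_summable t u)
  refine le_trans (le_of_eq ?_) this
  simp [ev, sub_smul, Finset.sum_sub_distrib]

lemma ev_bdd (x : XX n s) (M : ℝ) (hM : ∑ k : s, (1 + ((k:ℤ):ℝ) ^ 2) * ‖x k‖ ^ 2 ≤ M ^ 2) (hM0 : 0 ≤ M)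
    (t : UnitAddCircle) : ‖ev x t‖ ≤ Real.sqrt (∑' k : ℤ, (1 / (1 + (k:ℝ) ^ 2))) * M := by
  have h0 : (fun k : ℤ => ‖(fourier k t : ℂ)‖ ^ 2 * (1 / (1 + (k:ℝ) ^ 2))) = fun k : ℤ => 1 / (1 + (k:ℝ) ^ 2) := by
    funext k
    rw [norm_fourier_one, one_pow, one_mul]
  have := cs_bound x M hM hM0 (fun k => (fourier k t : ℂ)) (by rw [h0]; exact summable_weight)
  rw [h0] at this
  exact this

/-- Compactness. -/
lemma compactness (S : ℕ → Finset ℤ) (x : ∀ N, XX n (S N)) (M : ℝ) (hM0 : 0 ≤ M)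
    (hM : ∀ N, ∑ k : S N, (1 + ((k:ℤ):ℝ) ^ 2) * ‖x N k‖ ^ 2 ≤ M ^ 2) :
    ∃ (f : UnitAddCircle → Esp n) (φ : ℕ → ℕ) (R : ℝ), Continuous f ∧ StrictMono φ ∧
      (∀ N t, ‖ev (x N) t‖ ≤ R) ∧ (∀ t, Tendsto (fun N => ev (x (φ N)) t) atTop (𝓝 (f t))) := by
  set R := Real.sqrt (∑' k : ℤ, (1 / (1 + (k:ℝ) ^ 2))) * M
  let F : ℕ → BoundedContinuousFunction UnitAddCircle (Esp n) :=
    fun N => BoundedContinuousFunction.mkOfCompact ⟨ev (x N), ev_cont (x N)⟩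
  have hF : ∀ N t, F N t = ev (x N) t := fun N t => rfl
  have hK := BoundedContinuousFunction.arzela_ascoli (closedBall (0 : Esp n) R) (isCompact_closedBall _ _)
    (Set.range F) ?_ ?_
  · obtain ⟨f, _, φ, hφ, hf⟩ := hK.tendsto_subseq (x := F) (fun N => subset_closure ⟨N, rfl⟩)
    refine ⟨f, φ, R, f.continuous, hφ, fun N t => ev_bdd _ _ (hM N) hM0 t, fun t => ?_⟩
    exact ((continuous_eval_const (F := BoundedContinuousFunction UnitAddCircle (Esp n)) t).tendsto f).comp hf
  · rintro f t ⟨N, rfl⟩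
    rw [mem_closedBall_zero_iff]
    exact ev_bdd _ _ (hM N) hM0 t
  · intro t
    rw [Metric.equicontinuousAt_iff_right]
    intro ε hε
    have h1 : Continuous fun u => Real.sqrt (modl t u) * M := (modl_cont t).sqrt.mul_const M
    have h2 := h1.tendsto t
    rw [modl_self, Real.sqrt_zero, zero_mul] at h2
    filter_upwards [h2.eventually (gt_mem_nhds hε)] with u hu
    rintro ⟨f, N, rfl⟩
    rw [dist_eq_norm]
    exact (ev_modl _ _ (hM N) hM0 t u).trans_lt hu

lemma lim_int {F : Type*} [NormedAddCommGroup F] [NormedSpace ℝ F] (g : ℕ → UnitAddCircle → Esp n)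
    (hg : ∀ N, Continuous (g N)) (f : UnitAddCircle → Esp n) (R : ℝ) (hR : ∀ N t, ‖g N t‖ ≤ R)
    (hl : ∀ t, Tendsto (fun N => g N t) atTop (𝓝 (f t))) (K : UnitAddCircle → Esp n → F)
    (hK : Continuous (Function.uncurry K)) :
    Tendsto (fun N => ∫ t, K t (g N t) ∂haarAddCircle) atTop (𝓝 (∫ t, K t (f t) ∂haarAddCircle)) := by
  obtain ⟨B, hB⟩ := (isCompact_univ.prod (isCompact_closedBall (0 : Esp n) R)).exists_bound_of_continuousOn
    (f := Function.uncurry K) hK.continuousOn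
  refine tendsto_integral_of_dominated_convergence (fun _ => B) (fun N => ?_) (integrable_const _) ?_ ?_
  · exact (int_of_cont (hK.comp (continuous_id.prodMk (hg N)))).aestronglyMeasurable
  · intro N
    exact Eventually.of_forall fun t => hB (t, g N t) ⟨mem_univ _, mem_closedBall_zero_iff.2 (hR N t)⟩
  · refine Eventually.of_forall fun t => ?_
    exact (hK.tendsto (t, f t)).comp (tendsto_const_nhds.prodMk_nhds (hl t))

end

section
open MeasureTheory AddCircle Filter

variable {s : Finset ℤ}

lemma bessel (g : UnitAddCircle → Esp n) (hg : Continuous g) (B : ℝ) (hB0 : 0 ≤ B) (hB : ∀ t, ‖g t‖ ≤ B) :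
    ‖coefs s g‖ ≤ B := by
  have h1 := coefs_inner g hg (coefs s g)
  rw [real_inner_self_eq_norm_sq] at h1
  have h2 : ∫ t, inner ℝ (g t) (ev (coefs s g) t) ∂haarAddCircle
      ≤ ∫ t, (B ^ 2 / 2 + (1/2) * ‖ev (coefs s g) t‖ ^ 2) ∂haarAddCircle := by
    have hc := ev_cont (coefs s g)
    refine integral_mono (int_of_cont (hg.inner hc)) (int_of_cont (by fun_prop)) (fun t => ?_)
    have h3 := real_inner_le_norm (g t) (ev (coefs s g) t)
    have h4 := hB t
    have h5 := norm_nonneg (g t)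
    simp only
    nlinarith [sq_nonneg (‖g t‖ - ‖ev (coefs s g) t‖)]
  have hc := ev_cont (coefs s g)
  rw [integral_add (integrable_const _) (int_of_cont (by fun_prop)), integral_const_mul, ← normsq_eq_int] at h2
  simp at h2
  refine (sq_le_sq₀ (norm_nonneg _) hB0).1 ?_
  linarith

lemma fourierCoeff_add_cont (g h : UnitAddCircle → Esp n) (hg : Continuous g) (hh : Continuous h) (k : ℤ) :
    fourierCoeff (fun t => g t + h t) k = fourierCoeff g k + fourierCoeff h k := by
  unfold fourierCoeff
  rw [← integral_add]
  · simp [smul_add]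
  · exact int_of_cont ((fourier (-k)).continuous.smul hg)
  · exact int_of_cont ((fourier (-k)).continuous.smul hh)

lemma fourierCoeff_rsmul (c : ℝ) (g : UnitAddCircle → Esp n) (k : ℤ) :
    fourierCoeff (fun t => c • g t) k = c • fourierCoeff g k := by
  unfold fourierCoeff
  rw [← integral_smul]
  congr 1; funext t
  exact smul_comm _ _ _

lemma apriori (W w : Esp n → Esp n) (Cw : ℝ) (hC : 0 ≤ Cw) (hWc : Continuous W)
    (hW : ∀ x, W x = (3 * Real.pi) • x + w x) (hw : ∀ x, ‖w x‖ ≤ Cw) (x : XX n s) (hx : ‖gradPhi W x‖ ≤ 1) :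
    ∑ k : s, (1 + ((k:ℤ):ℝ) ^ 2) * ‖x k‖ ^ 2 ≤ (1 + Cw) ^ 2 := by
  have hwc : Continuous w := by
    have : w = fun x => W x - (3 * Real.pi) • x := by funext x; rw [hW]; simp
    rw [this]; fun_prop
  have hwe : Continuous fun t => w (ev x t) := hwc.comp (ev_cont x)
  set D : XX n s := WithLp.toLp 2 (fun k : s => (Real.pi * (2 * ((k : ℤ) : ℝ) - 3)) • x k) with hD
  have h1 : D = gradPhi W x + coefs s (fun t => w (ev x t)) := by
    ext k : 1
    simp only [hD, gradPhi, coefs, PiLp.add_apply]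
    have h2 : (fun t => W (ev x t)) = fun t => (3 * Real.pi) • ev x t + w (ev x t) := by
      funext t; rw [hW]
    rw [h2, fourierCoeff_add_cont (fun t => (3 * Real.pi) • ev x t) _ (by have := ev_cont x; fun_prop) hwe, fourierCoeff_rsmul, fourierCoeff_ev x k k.2]
    module
  have h2 : ‖D‖ ≤ 1 + Cw := by
    rw [h1]
    exact (norm_add_le _ _).trans (add_le_add hx (bessel _ hwe _ hC fun t => hw _))
  have h3 : ‖D‖ ^ 2 ≤ (1 + Cw) ^ 2 := by gcongr
  refine le_trans ?_ h3
  rw [PiLp.norm_sq_eq_of_L2]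
  refine Finset.sum_le_sum fun k _ => ?_
  simp only [hD, norm_smul, mul_pow, Real.norm_eq_abs, sq_abs]
  refine mul_le_mul_of_nonneg_right ?_ (by positivity)
  have h4 : (0:ℤ) ≤ ((k:ℤ) - 1) * ((k:ℤ) - 2) := by
    rcases le_or_gt (k:ℤ) 1 with h | h
    · nlinarith
    · have : 2 ≤ (k:ℤ) := h
      nlinarith
  have h5 : (0:ℝ) ≤ (((k:ℤ):ℝ) - 1) * (((k:ℤ):ℝ) - 2) := by exact_mod_cast h4
  have h6 : (9:ℝ) ≤ Real.pi ^ 2 := by nlinarith [Real.pi_gt_three]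
  have h7 : 9 * (2 * ((k : ℤ) : ℝ) - 3) ^ 2 ≤ Real.pi ^ 2 * (2 * ((k : ℤ) : ℝ) - 3) ^ 2 := by gcongr
  nlinarith [sq_nonneg (((k:ℤ):ℝ) - 3)]

lemma Phi_eq (Gb : Esp n → ℝ) (W : Esp n → Esp n) (hWc : Continuous W) (x : XX n s) :
    Phi Gb x = (1/2) * inner ℝ (gradPhi W x) x + (1/2) * ∫ t, inner ℝ (W (ev x t)) (ev x t) ∂haarAddCircle
      - ∫ t, Gb (ev x t) ∂haarAddCircle := by
  have h1 : gradPhi W x = WithLp.toLp 2 (fun k : s => (2 * Real.pi * ((k : ℤ) : ℝ)) • x k)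
      - coefs s (fun t => W (ev x t)) := by
    ext k : 1
    simp [gradPhi, coefs]
  rw [h1, inner_sub_left, coefs_inner (fun t => W (ev x t)) (hWc.comp (ev_cont x)), PiLp.inner_apply]
  simp only [real_inner_smul_left, real_inner_self_eq_norm_sq]
  unfold Phi
  have : ∑ k : s, 2 * Real.pi * ((k:ℤ):ℝ) * ‖x k‖ ^ 2 = 2 * (Real.pi * ∑ k : s, ((k:ℤ):ℝ) * ‖x k‖ ^ 2) := by
    rw [Finset.mul_sum, Finset.mul_sum]
    exact Finset.sum_congr rfl fun k _ => by ring
  rw [this]; ring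

theorem critical_loop {Gb : Esp n → ℝ} {W : Esp n → Esp n} {L C lam δ : ℝ} (hn : 1 ≤ n) (h : Adm Gb W L C lam δ)
    (w : Esp n → Esp n) (Cw : ℝ) (hC : 0 ≤ Cw)
    (hW : ∀ x, W x = (3 * Real.pi) • x + w x) (hw : ∀ x, ‖w x‖ ≤ Cw) :
    ∃ f : UnitAddCircle → Esp n, Continuous f ∧
      (∀ k : ℤ, (2 * Real.pi * (k:ℝ)) • fourierCoeff f k = fourierCoeff (fun t => W (f t)) k) ∧
      0 < (1/2) * ∫ t, inner ℝ (W (f t)) (f t) ∂haarAddCircle - ∫ t, Gb (f t) ∂haarAddCircle := by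
  obtain ⟨β, hβ, hgal⟩ := galerkin hn h
  let S : ℕ → Finset ℤ := fun N => Finset.Icc (-((N:ℤ) + 1)) ((N:ℤ) + 1)
  have hS1 : ∀ N, (1:ℤ) ∈ S N := fun N => Finset.mem_Icc.2 ⟨by omega, by omega⟩
  choose x hxβ hxg using fun N : ℕ => hgal (S N) (hS1 N) (1 / ((N:ℝ) + 1)) (by positivity)
  have hg1 : ∀ N, ‖gradPhi W (x N)‖ ≤ 1 := fun N => (hxg N).le.trans (by
    rw [div_le_one (by positivity)]; linarith [Nat.cast_nonneg (α := ℝ) N])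
  have hM := fun N => apriori W w Cw hC h.contW hW hw (x N) (hg1 N)
  obtain ⟨f, φ, R, hf, hφ, hR, hl⟩ := compactness S x (1 + Cw) (by positivity) hM
  have hR' : ∀ N t, ‖ev (x (φ N)) t‖ ≤ R := fun N t => hR _ t
  have hc : ∀ N, Continuous (ev (x (φ N))) := fun N => ev_cont _
  have hgrad0 : Tendsto (fun N => ‖gradPhi W (x (φ N))‖) atTop (𝓝 0) := by
    have h0 : Tendsto (fun N : ℕ => 1 / ((N:ℝ) + 1)) atTop (𝓝 0) := tendsto_one_div_add_atTop_nhds_zero_nat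
    exact squeeze_zero (fun N => norm_nonneg _) (fun N => (hxg (φ N)).le) (h0.comp hφ.tendsto_atTop)
  refine ⟨f, hf, fun k => ?_, ?_⟩
  · have hf1 : Tendsto (fun N => fourierCoeff (ev (x (φ N))) k) atTop (𝓝 (fourierCoeff f k)) := by
      unfold fourierCoeff
      exact lim_int _ hc f R hR' hl (fun t y => (fourier (-k) t : ℂ) • y)
        (((fourier (-k)).continuous.comp continuous_fst).smul continuous_snd)
    have hf2 : Tendsto (fun N => fourierCoeff (fun t => W (ev (x (φ N)) t)) k) atTop (𝓝 (fourierCoeff (fun t => W (f t)) k)) := by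
      unfold fourierCoeff
      exact lim_int _ hc f R hR' hl (fun t y => (fourier (-k) t : ℂ) • W y)
        (((fourier (-k)).continuous.comp continuous_fst).smul (h.contW.comp continuous_snd))
    have h3 := (hf1.const_smul (2 * Real.pi * (k:ℝ))).sub hf2
    have h4 : Tendsto (fun N => (2 * Real.pi * (k:ℝ)) • fourierCoeff (ev (x (φ N))) k
        - fourierCoeff (fun t => W (ev (x (φ N)) t)) k) atTop (𝓝 0) := by
      refine squeeze_zero_norm' ?_ hgrad0
      filter_upwards [hφ.tendsto_atTop.eventually (eventually_ge_atTop k.natAbs)] with N hN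
      have hk : k ∈ S (φ N) := Finset.mem_Icc.2 ⟨by omega, by omega⟩
      rw [fourierCoeff_ev _ k hk]
      exact PiLp.norm_apply_le (gradPhi W (x (φ N))) ⟨k, hk⟩
    exact sub_eq_zero.1 (tendsto_nhds_unique h3 h4)
  · refine hβ.trans_le ?_
    have h1 := lim_int _ hc f R hR' hl (fun t y => (inner ℝ (W y) y : ℝ))
        ((h.contW.comp continuous_snd).inner continuous_snd)
    have h2 := lim_int _ hc f R hR' hl (fun t y => Gb y) (h.contG.comp continuous_snd)
    have hxn : ∀ N, ‖x N‖ ≤ 1 + Cw := by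
      intro N
      refine (sq_le_sq₀ (norm_nonneg _) (by positivity)).1 (le_trans ?_ (hM N))
      rw [PiLp.norm_sq_eq_of_L2]
      refine Finset.sum_le_sum fun k _ => ?_
      nlinarith [sq_nonneg ‖x N k‖, mul_nonneg (sq_nonneg ((k:ℤ):ℝ)) (sq_nonneg ‖x N k‖)]
    have h3 : Tendsto (fun N => (inner ℝ (gradPhi W (x (φ N))) (x (φ N)) : ℝ)) atTop (𝓝 0) := by
      have h4 := hgrad0.mul_const (1 + Cw)
      rw [zero_mul] at h4
      refine squeeze_zero_norm (fun N => (norm_inner_le_norm _ _).trans ?_) h4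
      gcongr
      exact hxn _
    have h5 := ((h3.const_mul (1/2)).add (h1.const_mul (1/2))).sub h2
    rw [mul_zero, zero_add] at h5
    refine ge_of_tendsto' h5 fun N => ?_
    have := hxβ (φ N)
    rwa [Phi_eq Gb W h.contW] at this

end

section
open MeasureTheory AddCircle Filter

lemma fc_int (g : UnitAddCircle → ℂ) (k : ℤ) (a : ℝ) :
    fourierCoeff g k = ∫ t in a..(a+1), (fourier (-k) (t : UnitAddCircle) : ℂ) * g t := by
  rw [fourierCoeff_eq_intervalIntegral g k a]; simp

lemma loop_ode_scalar (f V : UnitAddCircle → ℂ) (hf : Continuous f) (hV : Continuous V)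
    (h : ∀ k : ℤ, (2 * Real.pi * (k:ℝ)) • fourierCoeff f k = fourierCoeff V k) (t : ℝ) :
    HasDerivAt (fun t : ℝ => f (t : UnitAddCircle)) (Complex.I * V (t : UnitAddCircle)) t := by
  have hco : Continuous fun t : ℝ => (t : UnitAddCircle) := AddCircle.continuous_mk' 1
  have hVc : Continuous fun t : ℝ => Complex.I * V (t : UnitAddCircle) := continuous_const.mul (hV.comp hco)
  set G : ℝ → ℂ := fun t => ∫ u in (0:ℝ)..t, Complex.I * V (u : UnitAddCircle) with hG
  have hGd : ∀ t : ℝ, HasDerivAt G (Complex.I * V (t : UnitAddCircle)) t := fun t =>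
    intervalIntegral.integral_hasDerivAt_right (hVc.intervalIntegrable _ _)
      (hVc.stronglyMeasurableAtFilter _ _) hVc.continuousAt
  have hGc : Continuous G := continuous_iff_continuousAt.2 fun t => (hGd t).continuousAt
  have hV0 : fourierCoeff V 0 = 0 := by rw [← h 0]; simp
  have hGp : Function.Periodic G 1 := by
    intro a
    have h1 : G (a + 1) - G a = ∫ u in a..(a+1), Complex.I * V (u : UnitAddCircle) :=
      intervalIntegral.integral_interval_sub_left (hVc.intervalIntegrable _ _) (hVc.intervalIntegrable _ _)
    have h2 := fc_int V 0 a
    rw [hV0] at h2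
    simp at h2
    rw [intervalIntegral.integral_const_mul, ← h2, mul_zero] at h1
    exact sub_eq_zero.1 h1
  let Gc : UnitAddCircle → ℂ := hGp.lift
  have hGl : ∀ t : ℝ, Gc (t : UnitAddCircle) = G t := fun t => hGp.lift_coe t
  have hGcc : Continuous Gc := by
    refine continuous_quot_lift _ hGc
  have hcoef : ∀ k : ℤ, (2 * Real.pi * (k:ℝ)) • fourierCoeff Gc k = fourierCoeff V k := by
    intro k
    have hfd := fun t : ℝ => (hasDerivAt_fourier_neg 1 k t).mul (hGd t)
    have hfc : Continuous fun t : ℝ => (fourier (-k) (t : UnitAddCircle) : ℂ) := (fourier (-k)).continuous.comp hco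
    have hI := intervalIntegral.integral_eq_sub_of_hasDerivAt (a := 0) (b := 0 + 1) (fun t _ => hfd t) (by
      apply Continuous.intervalIntegrable
      fun_prop)
    have hz : (fourier (-k) ((0 + 1 : ℝ) : UnitAddCircle) : ℂ) * G (0 + 1) - (fourier (-k) ((0 : ℝ) : UnitAddCircle) : ℂ) * G 0 = 0 := by
      rw [hGp 0, AddCircle.coe_add, AddCircle.coe_period, add_zero, sub_self]
    simp only [Pi.mul_apply] at hI
    rw [hz, intervalIntegral.integral_add] at hI
    rotate_left
    · apply Continuous.intervalIntegrable; fun_prop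
    · apply Continuous.intervalIntegrable; fun_prop
    rw [fc_int Gc k 0, fc_int V k 0]
    simp only [hGl]
    have e1 : ∀ t : ℝ, -2 * (Real.pi:ℂ) * Complex.I * k / (1:ℝ) * (fourier (-k) (t : UnitAddCircle) : ℂ) * G t
        = (-2 * (Real.pi:ℂ) * Complex.I * k) * ((fourier (-k) (t : UnitAddCircle) : ℂ) * G t) := by
      intro t; push_cast; ring
    have e2 : ∀ t : ℝ, (fourier (-k) (t : UnitAddCircle) : ℂ) * (Complex.I * V t) = Complex.I * ((fourier (-k) (t : UnitAddCircle) : ℂ) * V t) := by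
      intro t; ring
    simp only [e1, e2] at hI
    rw [intervalIntegral.integral_const_mul, intervalIntegral.integral_const_mul] at hI
    rw [Complex.real_smul]
    push_cast
    have hI0 := Complex.I_ne_zero
    apply mul_left_cancel₀ hI0
    linear_combination -hI
  have hdiff : ∀ k : ℤ, k ≠ 0 → fourierCoeff (fun t => f t - Gc t) k = 0 := by
    intro k hk
    have h1 : fourierCoeff (fun t => f t - Gc t) k = fourierCoeff f k - fourierCoeff Gc k := by
      unfold fourierCoeff
      rw [← integral_sub]
      · simp [smul_sub, mul_sub]
      · exact int_of_cont ((fourier (-k)).continuous.smul hf)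
      · exact int_of_cont ((fourier (-k)).continuous.smul hGcc)
    have h2 : (2 * Real.pi * (k:ℝ)) ≠ 0 := by
      have : (k:ℝ) ≠ 0 := by exact_mod_cast hk
      have := Real.pi_pos.ne'
      positivity
    rw [h1, sub_eq_zero]
    exact smul_right_injective ℂ h2 ((h k).trans (hcoef k).symm)
  let D : C(UnitAddCircle, ℂ) := ⟨fun t => f t - Gc t, hf.sub hGcc⟩
  have hsum : Summable (fourierCoeff D) := summable_of_ne_finset_zero (s := {0}) (fun k hk => hdiff k (by simpa using hk))
  have hconst : ∀ t : UnitAddCircle, f t = Gc t + fourierCoeff D 0 := by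
    intro t
    have h1 := has_pointwise_sum_fourier_series_of_summable hsum t
    have h2 := h1.unique (hasSum_single 0 (fun k hk => by
      rw [show fourierCoeff D k = 0 from hdiff k hk, zero_smul]))
    have h3 : D t = f t - Gc t := rfl
    rw [h3] at h2
    rw [fourier_zero, smul_eq_mul, mul_one] at h2
    rw [← h2]; ring
  have : (fun t : ℝ => f (t : UnitAddCircle)) = fun t : ℝ => G t + fourierCoeff D 0 := by
    funext t; rw [hconst, hGl]
  rw [this]
  exact (hGd t).add_const _


lemma fc_coord (g : UnitAddCircle → Esp n) (hg : Continuous g) (k : ℤ) (i : Fin n) :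
    fourierCoeff (fun t => g t i) k = fourierCoeff g k i := by
  unfold fourierCoeff
  have h1 := (EuclideanSpace.proj (𝕜 := ℂ) i : Esp n →L[ℂ] ℂ).integral_comp_comm
    (int_of_cont (f := fun t => (fourier (-k) t : ℂ) • g t) ((fourier (-k)).continuous.smul hg))
  simpa using h1

lemma loop_ode (f V : UnitAddCircle → Esp n) (hf : Continuous f) (hV : Continuous V)
    (h : ∀ k : ℤ, (2 * Real.pi * (k:ℝ)) • fourierCoeff f k = fourierCoeff V k) (t : ℝ) :
    HasDerivAt (fun t : ℝ => f (t : UnitAddCircle)) (Complex.I • V (t : UnitAddCircle)) t := by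
  have h1 : HasDerivAt (fun t : ℝ => WithLp.ofLp (f (t : UnitAddCircle)))
      (WithLp.ofLp (Complex.I • V (t : UnitAddCircle))) t := by
    rw [hasDerivAt_pi]
    intro i
    have := loop_ode_scalar (fun t => f t i) (fun t => V t i) (by fun_prop) (by fun_prop) (fun k => by
      rw [fc_coord f hf, fc_coord V hV, ← h k]; simp) t
    simpa using this
  exact (PiLp.continuousLinearEquiv 2 ℝ (fun _ : Fin n => ℂ)).symm.hasFDerivAt.comp_hasDerivAt t h1

end

section
open MeasureTheory AddCircle Filter


/-- Primitive vanishing at `0`. -/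
def prim (χ : ℝ → ℝ) (s : ℝ) : ℝ := ∫ u in (0:ℝ)..s, χ u

lemma prim_deriv {χ : ℝ → ℝ} (h : Continuous χ) (s : ℝ) : HasDerivAt (prim χ) (χ s) s :=
  intervalIntegral.integral_hasDerivAt_right (h.intervalIntegrable _ _)
    (h.stronglyMeasurableAtFilter _ _) h.continuousAt

lemma prim_contDiff {χ : ℝ → ℝ} (h : ContDiff ℝ (⊤ : ℕ∞) χ) : ContDiff ℝ (⊤ : ℕ∞) (prim χ) := by
  rw [contDiff_infty_iff_deriv]
  refine ⟨fun s => (prim_deriv h.continuous s).differentiableAt, ?_⟩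
  have : deriv (prim χ) = χ := by
    funext s; exact (prim_deriv h.continuous s).deriv
  rw [this]; exact h

lemma prim_mono {χ : ℝ → ℝ} (h : Continuous χ) (h0 : ∀ s, 0 ≤ χ s) : Monotone (prim χ) :=
  monotone_of_hasDerivAt_nonneg (prim_deriv h) h0

lemma prim_zero (χ : ℝ → ℝ) : prim χ 0 = 0 := by simp [prim]

lemma rad_grad {χ : ℝ → ℝ} (h : Continuous χ) (x : Esp n) :
    HasGradientAt (fun x : Esp n => prim χ (‖x‖ ^ 2)) ((2 * χ (‖x‖ ^ 2)) • x) x := by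
  rw [hasGradientAt_iff_hasFDerivAt]
  have h1 : HasFDerivAt (fun x : Esp n => ‖x‖ ^ 2) (2 • (innerSL ℝ x)) x := (hasStrictFDerivAt_norm_sq x).hasFDerivAt
  have h2 := (prim_deriv h (‖x‖ ^ 2)).comp_hasFDerivAt x h1
  refine h2.congr_fderiv ?_
  ext y
  simp
  ring

lemma rad_smooth {χ : ℝ → ℝ} (h : ContDiff ℝ (⊤ : ℕ∞) χ) : ContDiff ℝ (⊤ : ℕ∞) (fun x : Esp n => χ (‖x‖ ^ 2)) :=
  h.comp (contDiff_norm_sq ℝ)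

lemma grad_smooth {H : Esp n → ℝ} (h : ContDiff ℝ (⊤ : ℕ∞) H) : ContDiff ℝ (⊤ : ℕ∞) (gradient H) := by
  have h1 : ContDiff ℝ (⊤ : ℕ∞) (fderiv ℝ H) := h.fderiv_right (by simp)
  exact ((InnerProductSpace.toDual ℝ (Esp n)).symm.toContinuousLinearEquiv.contDiff).comp h1

lemma grad_zero_of_notMem {H : Esp n → ℝ} {x : Esp n} (hx : x ∉ tsupport H) : gradient H x = 0 := by
  have h1 : fderiv ℝ H x = 0 := by
    by_contra h
    exact hx (support_fderiv_subset ℝ h)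
  simp [gradient, h1]

lemma quad_of_lipschitz {Gb : Esp n → ℝ} {W : Esp n → Esp n} {K : ℝ≥0} (hG : ∀ x, HasGradientAt Gb (W x) x)
    (hW : LipschitzWith K W) (x y : Esp n) : Gb x + inner ℝ (W x) (y - x) - K * ‖y - x‖ ^ 2 ≤ Gb y := by
  have hd : ∀ t : ℝ, HasDerivAt (fun t : ℝ => Gb (x + t • (y - x))) (inner ℝ (W (x + t • (y - x))) (y - x)) t := by
    intro t
    have h1 : HasDerivAt (fun t : ℝ => x + t • (y - x)) (y - x) t := by
      simpa using ((hasDerivAt_id t).smul_const (y - x)).const_add x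
    have h2 := (hasGradientAt_iff_hasFDerivAt.1 (hG (x + t • (y - x)))).comp_hasDerivAt t h1
    exact h2
  obtain ⟨t, ht, hs⟩ := exists_hasDerivAt_eq_slope (fun t : ℝ => Gb (x + t • (y - x)))
    (fun t => inner ℝ (W (x + t • (y - x))) (y - x)) zero_lt_one
    (continuous_iff_continuousAt.2 fun t => (hd t).continuousAt).continuousOn (fun t _ => hd t)
  simp only [one_smul, zero_smul, add_zero, sub_zero, div_one, add_sub_cancel] at hs
  have h3 : ‖W x - W (x + t • (y - x))‖ ≤ K * ‖y - x‖ := by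
    have h4 := hW.dist_le_mul x (x + t • (y - x))
    rw [dist_eq_norm, dist_eq_norm] at h4
    refine h4.trans ?_
    gcongr
    rw [sub_add_cancel_left, norm_neg, norm_smul, Real.norm_of_nonneg ht.1.le]
    nlinarith [norm_nonneg (y - x), ht.2]
  have h5 : inner ℝ (W x - W (x + t • (y - x))) (y - x) ≤ K * ‖y - x‖ * ‖y - x‖ :=
    (real_inner_le_norm _ _).trans (by gcongr)
  rw [inner_sub_left] at h5
  nlinarith

lemma rot_unique {V : Esp n → Esp n} {K : ℝ≥0} (hV : LipschitzWith K V) {γ : ℝ → Esp n}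
    (hγ : ∀ t, HasDerivAt γ (V (γ t)) t) (t0 a : ℝ)
    (ha : ∀ y, ‖y‖ = ‖γ t0‖ → V y = ((a:ℂ) * Complex.I) • y) (t : ℝ) :
    γ t = Complex.exp (((a * (t - t0) : ℝ) : ℂ) * Complex.I) • γ t0 := by
  have h := ODE_solution_unique_univ (v := fun _ => V) (s := fun _ => univ) (K := K) (f := γ)
    (g := fun t : ℝ => Complex.exp (((a * (t - t0) : ℝ) : ℂ) * Complex.I) • γ t0) (t₀ := t0)
    (fun _ => hV.lipschitzOnWith) (fun t => ⟨hγ t, mem_univ _⟩) (fun t => ⟨?_, mem_univ _⟩) (by simp)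
  · exact congrFun h t
  · have hn : ‖Complex.exp (((a * (t - t0) : ℝ) : ℂ) * Complex.I) • γ t0‖ = ‖γ t0‖ := by
      rw [norm_smul, Complex.norm_exp_ofReal_mul_I, one_mul]
    rw [ha _ hn, smul_smul]
    have h1 : HasDerivAt (fun t : ℝ => ((a * (t - t0) : ℝ) : ℂ) * Complex.I) ((a:ℂ) * Complex.I) t := by
      have h2 : HasDerivAt (fun t : ℝ => a * (t - t0)) a t := by
        simpa using ((hasDerivAt_id t).sub_const t0).const_mul a
      exact h2.ofReal_comp.mul_const _
    have h3 := h1.cexp.smul_const (γ t0)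
    rw [mul_comm] at h3
    exact h3

lemma rot_period {a : ℝ} {v : Esp n} (hv : v ≠ 0) (h : Complex.exp (((a : ℝ) : ℂ) * Complex.I) • v = v) :
    ∃ m : ℤ, a = m * (2 * Real.pi) := by
  have h1 : Complex.exp (((a : ℝ) : ℂ) * Complex.I) = 1 := by
    by_contra hne
    have : (Complex.exp (((a : ℝ) : ℂ) * Complex.I) - 1) • v = 0 := by rw [sub_smul, h, one_smul, sub_self]
    rcases smul_eq_zero.1 this with h2 | h2
    · exact hne (sub_eq_zero.1 h2)
    · exact hv h2
  obtain ⟨m, hm⟩ := Complex.exp_eq_one_iff.1 h1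
  refine ⟨m, ?_⟩
  rw [← mul_assoc] at hm
  have := mul_right_cancel₀ Complex.I_ne_zero (hm.trans (by ring : _ = ((m:ℂ) * (2 * Real.pi)) * Complex.I))
  exact_mod_cast this

end

section
open MeasureTheory AddCircle Filter


/-- Slope profile used to modify a Hamiltonian at infinity. -/
def hslope (r d : ℝ) (s : ℝ) : ℝ := (3 * Real.pi / 2) * Real.smoothTransition ((s - r ^ 2) / d)

lemma hslope_smooth (r d : ℝ) : ContDiff ℝ (⊤ : ℕ∞) (hslope r d) := by
  unfold hslope
  refine contDiff_const.mul (Real.smoothTransition.contDiff.comp ?_)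
  fun_prop

lemma hslope_zero {r d s : ℝ} (hd : 0 < d) (h : s ≤ r ^ 2) : hslope r d s = 0 := by
  unfold hslope
  rw [Real.smoothTransition.zero_of_nonpos, mul_zero]
  exact div_nonpos_of_nonpos_of_nonneg (by linarith) hd.le

lemma hslope_top {r d s : ℝ} (hd : 0 < d) (h : r ^ 2 + d ≤ s) : hslope r d s = 3 * Real.pi / 2 := by
  unfold hslope
  rw [Real.smoothTransition.one_of_one_le, mul_one]
  rw [le_div_iff₀ hd]; linarith

lemma hslope_nonneg (r d s : ℝ) : 0 ≤ hslope r d s := by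
  have := Real.pi_pos
  have := Real.smoothTransition.nonneg ((s - r ^ 2) / d)
  unfold hslope; positivity

lemma hslope_le (r d s : ℝ) : hslope r d s ≤ 3 * Real.pi / 2 := by
  have := Real.pi_pos
  have := Real.smoothTransition.le_one ((s - r ^ 2) / d)
  unfold hslope; nlinarith

lemma prim_hslope_zero {r d s : ℝ} (hd : 0 < d) (h0 : 0 ≤ s) (h : s ≤ r ^ 2) : prim (hslope r d) s = 0 := by
  unfold prim
  rw [intervalIntegral.integral_congr (g := fun _ => (0:ℝ))]
  · simp
  · intro u hu
    rw [uIcc_of_le h0] at hu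
    exact hslope_zero hd (hu.2.trans h)

lemma prim_hslope_nonneg (r d : ℝ) {s : ℝ} (h0 : 0 ≤ s) : 0 ≤ prim (hslope r d) s := by
  have := prim_mono (hslope_smooth r d).continuous (hslope_nonneg r d) h0
  rwa [prim_zero] at this

lemma prim_hslope_le (r d : ℝ) {s : ℝ} (h0 : 0 ≤ s) : prim (hslope r d) s ≤ (3 * Real.pi / 2) * s := by
  have h1 : Monotone fun s => (3 * Real.pi / 2) * s - prim (hslope r d) s := by
    refine monotone_of_hasDerivAt_nonneg (f' := fun s => (3 * Real.pi / 2) - hslope r d s) (fun s => ?_)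
      (fun s => sub_nonneg.2 (hslope_le r d s))
    have := ((hasDerivAt_id s).const_mul (3 * Real.pi / 2)).sub (prim_deriv (hslope_smooth r d).continuous s)
    rw [mul_one] at this
    exact this
  have := h1 h0
  simp only [mul_zero, prim_zero, sub_zero] at this
  linarith

lemma prim_hslope_ge {r d s : ℝ} (hd : 0 < d) (h0 : 0 ≤ s) :
    (3 * Real.pi / 2) * (s - (r ^ 2 + d)) ≤ prim (hslope r d) s := by
  have hpi := Real.pi_pos
  rcases le_total s (r ^ 2 + d) with h | h
  · refine le_trans ?_ (prim_hslope_nonneg r d h0)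
    exact mul_nonpos_of_nonneg_of_nonpos (by positivity) (by linarith)
  · have hc := (hslope_smooth r d).continuous
    have h1 : prim (hslope r d) s - prim (hslope r d) (r ^ 2 + d) = ∫ u in (r ^ 2 + d)..s, hslope r d u :=
      intervalIntegral.integral_interval_sub_left (hc.intervalIntegrable _ _) (hc.intervalIntegrable _ _)
    rw [intervalIntegral.integral_congr (g := fun _ => 3 * Real.pi / 2)] at h1
    · rw [intervalIntegral.integral_const, smul_eq_mul] at h1
      have h2 := prim_hslope_nonneg r d (s := r ^ 2 + d) (by positivity)
      linarith
    · intro u hu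
      rw [uIcc_of_le h] at hu
      exact hslope_top hd hu.1

/-- The modified Hamiltonian. -/
def modG (r d c : ℝ) (H : Esp n → ℝ) (x : Esp n) : ℝ := c - H x + prim (hslope r d) (‖x‖ ^ 2)

def modW (r d : ℝ) (H : Esp n → ℝ) (x : Esp n) : Esp n := - gradient H x + (2 * hslope r d (‖x‖ ^ 2)) • x

def modw (r d : ℝ) (H : Esp n → ℝ) (x : Esp n) : Esp n :=
  - gradient H x + (2 * hslope r d (‖x‖ ^ 2) - 3 * Real.pi) • x

lemma modG_grad {r d c : ℝ} {H : Esp n → ℝ} (hH : ContDiff ℝ (⊤ : ℕ∞) H) (x : Esp n) :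
    HasGradientAt (modG r d c H) (modW r d H x) x := by
  have h1 : HasGradientAt H (gradient H x) x := (hH.differentiable (by simp) x).hasGradientAt
  have h2 := rad_grad (hslope_smooth r d).continuous x
  rw [hasGradientAt_iff_hasFDerivAt] at *
  have := (h1.const_sub c).add h2
  refine this.congr_fderiv ?_
  simp [modW]

lemma modW_eq (r d : ℝ) (H : Esp n → ℝ) (x : Esp n) : modW r d H x = (3 * Real.pi) • x + modw r d H x := by
  unfold modW modw; module

lemma modw_smooth {r d : ℝ} {H : Esp n → ℝ} (hH : ContDiff ℝ (⊤ : ℕ∞) H) : ContDiff ℝ (⊤ : ℕ∞) (modw r d H) := by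
  unfold modw
  have h1 := grad_smooth hH
  have h2 := rad_smooth (n := n) (hslope_smooth r d)
  exact h1.neg.add (((contDiff_const.mul h2).sub contDiff_const).smul contDiff_id)

lemma modw_support {r d : ℝ} (hr : 0 < r) (hd : 0 < d) {H : Esp n → ℝ} (hs : tsupport H ⊆ ball 0 r) :
    HasCompactSupport (modw r d H) := by
  refine HasCompactSupport.intro (isCompact_closedBall (0 : Esp n) (Real.sqrt (r ^ 2 + d))) fun x hx => ?_
  rw [mem_closedBall_zero_iff, not_le] at hx
  have h1 : r ^ 2 + d < ‖x‖ ^ 2 := (Real.sqrt_lt' ((Real.sqrt_nonneg _).trans_lt hx)).1 hx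
  have h2 : x ∉ tsupport H := by
    intro h
    have := mem_ball_zero_iff.1 (hs h)
    nlinarith [norm_nonneg x]
  unfold modw
  rw [grad_zero_of_notMem h2, hslope_top hd h1.le]
  simp [show 2 * (3 * Real.pi / 2) - 3 * Real.pi = 0 by ring]

theorem upper_key (hn : 1 ≤ n) {r : ℝ} (hr : 0 < r) {H : Esp n → ℝ}
    (hH : InHclass (ball (0 : Esp n) r) {0} H) (hc : Real.pi * r ^ 2 < H 0) : HasFastOrbit H := by
  obtain ⟨hsm, hcpt, hsupp, ⟨U, hUo, hU0, c', hUc⟩, hmax⟩ := hH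
  have hpi := Real.pi_pos
  set c := H 0 with hcdef
  have hmax' : ∀ x, H x ≤ c := hmax 0 rfl
  have h0U : (0 : Esp n) ∈ U := hU0 rfl
  have hUc' : ∀ x ∈ U, H x = c := fun x hx => by rw [hUc x hx, hcdef, hUc 0 h0U]
  set d : ℝ := (c - Real.pi * r ^ 2) / Real.pi with hd_def
  have hd : 0 < d := div_pos (by linarith) hpi
  have hdc : Real.pi * (r ^ 2 + d) = c := by rw [hd_def]; field_simp; ring
  have hc0 : 0 < c := lt_trans (by positivity) hc
  -- Lipschitz
  obtain ⟨K, hK⟩ := (modw_smooth (r := r) (d := d) hsm).lipschitzWith_of_hasCompactSupport (modw_support hr hd hsupp) (by simp)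
  have hWlip : LipschitzWith (‖(3 * Real.pi)‖₊ + K) (modW r d H) := by
    have h1 : LipschitzWith ‖(3 * Real.pi)‖₊ (fun x : Esp n => (3 * Real.pi) • x) := lipschitzWith_smul _
    have h2 := h1.add hK
    have h3 : modW r d H = fun x => (3 * Real.pi) • x + modw r d H x := by funext x; exact modW_eq r d H x
    rw [h3]; exact h2
  obtain ⟨Cw, hCw⟩ := (modw_support hr hd hsupp).exists_bound_of_continuous (modw_smooth (r := r) (d := d) hsm).continuous
  obtain ⟨B, hB⟩ := HasCompactSupport.exists_bound_of_continuous (f := H) hcpt hsm.continuous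
  have hB0 : 0 ≤ B := (norm_nonneg _).trans (hB 0)
  have hCw0 : 0 ≤ Cw := (norm_nonneg _).trans (hCw 0)
  obtain ⟨δ, hδ, hδU, hδr⟩ : ∃ δ > 0, closedBall (0 : Esp n) δ ⊆ U ∧ δ ≤ r := by
    obtain ⟨ε, hε, hεU⟩ := Metric.nhds_basis_closedBall.mem_iff.1 (hUo.mem_nhds h0U)
    exact ⟨min ε r, lt_min hε hr, (closedBall_subset_closedBall (min_le_left _ _)).trans hεU, min_le_right _ _⟩
  have hzero : ∀ x : Esp n, ‖x‖ ≤ δ → modG r d c H x = 0 := by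
    intro x hx
    unfold modG
    rw [hUc' x (hδU (mem_closedBall_zero_iff.2 hx)), prim_hslope_zero hd (by positivity) (by
      have := norm_nonneg x
      have : ‖x‖ ≤ r := hx.trans hδr
      gcongr)]
    ring
  have hnonneg : ∀ x : Esp n, 0 ≤ modG r d c H x := fun x => by
    have := prim_hslope_nonneg r d (sq_nonneg ‖x‖)
    have := hmax' x
    unfold modG; linarith
  set C : ℝ := 3 * Real.pi / 2 + (c + B) / δ ^ 2 + (3 * Real.pi / 2) * (r ^ 2 + d) with hCdef
  have hadm : Adm (modG r d c H) (modW r d H) ((‖(3 * Real.pi)‖₊ + K : ℝ≥0) : ℝ) C (3 * Real.pi / 2) δ := by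
    refine ⟨?_, hWlip.continuous, NNReal.coe_nonneg _, by positivity, quad_of_lipschitz (modG_grad hsm) hWlip,
      hnonneg, hδ, hzero, fun x => ?_, by linarith, fun x => ?_⟩
    · exact continuous_iff_continuousAt.2 fun x => (modG_grad hsm x).continuousAt
    · rcases le_total ‖x‖ δ with h | h
      · rw [hzero x h]; positivity
      · have h1 := prim_hslope_le r d (sq_nonneg ‖x‖)
        have h2 : c + B ≤ (c + B) / δ ^ 2 * ‖x‖ ^ 2 := by
          rw [div_mul_eq_mul_div, le_div_iff₀ (by positivity)]
          gcongr
        have h3 := neg_le_of_abs_le (hB x)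
        have h4 : 0 ≤ (3 * Real.pi / 2) * (r ^ 2 + d) * ‖x‖ ^ 2 := by positivity
        unfold modG
        rw [hCdef, add_mul, add_mul]
        linarith
    · have h1 := prim_hslope_ge (r := r) hd (sq_nonneg ‖x‖)
      have h2 := hmax' x
      have h3 : 0 ≤ (c + B) / δ ^ 2 := by positivity
      unfold modG
      rw [hCdef]
      linarith
  obtain ⟨f, hf, hfc, hval⟩ := critical_loop hn hadm (modw r d H) Cw hCw0 (modW_eq r d H) hCw
  have hode := loop_ode f (fun t => modW r d H (f t)) hf (hWlip.continuous.comp hf) hfc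
  set γ : ℝ → Esp n := fun t => f (t : UnitAddCircle) with hγ
  have hper : ∀ t, γ (t + 1) = γ t := by
    intro t
    simp only [hγ, AddCircle.coe_add, AddCircle.coe_period, add_zero]
  have hsurj : ∀ u : UnitAddCircle, ∃ t : ℝ, (t : UnitAddCircle) = u := fun u => QuotientAddGroup.mk_surjective u
  have hV : LipschitzWith (‖(3 * Real.pi)‖₊ + K) (fun x => Complex.I • modW r d H x) := by
    refine LipschitzWith.of_dist_le_mul fun x y => ?_
    rw [dist_eq_norm, ← smul_sub, norm_smul, Complex.norm_I, one_mul, ← dist_eq_norm]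
    exact hWlip.dist_le_mul x y
  by_cases hin : ∀ t, ‖γ t‖ < r
  · have hW : ∀ t, modW r d H (γ t) = - gradient H (γ t) := by
      intro t
      unfold modW
      rw [hslope_zero hd (by have := hin t; gcongr)]
      simp
    refine ⟨fun t => γ (-t), 1, ⟨one_pos, fun t => ?_, fun t => ?_, ?_⟩, le_rfl⟩
    · have h1 := (hode (-t)).scomp t (hasDerivAt_neg t)
      have h2 : (-1 : ℝ) • Complex.I • modW r d H (f ((-t : ℝ) : UnitAddCircle)) = hamVF H (γ (-t)) := by
        have := hW (-t)
        simp only [hγ] at this ⊢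
        rw [this]; unfold hamVF; simp
      rw [h2] at h1
      exact h1
    · have := hper (-(t + 1))
      rw [show -(t + 1) + 1 = -t by ring] at this
      exact this.symm
    · by_contra hcon
      push Not at hcon
      have hconst : ∀ t, γ t = γ 0 := fun t => by
        have := hcon (-t) 0
        simpa using this
      have hW0 : ∀ t : ℝ, modW r d H (γ t) = 0 := by
        intro t
        have h1 : HasDerivAt γ 0 t := by
          have : γ = fun _ => γ 0 := funext hconst
          rw [this]; exact hasDerivAt_const _ _
        have h2 := (hode t).unique h1
        simpa using h2
      have h3 : (fun t => (inner ℝ (modW r d H (f t)) (f t) : ℝ)) = fun _ => 0 := by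
        funext u
        obtain ⟨t, rfl⟩ := hsurj u
        have := hW0 t
        simp only [hγ] at this
        rw [this, inner_zero_left]
      rw [h3] at hval
      have h4 : 0 ≤ ∫ t, modG r d c H (f t) ∂haarAddCircle := integral_nonneg fun t => hnonneg _
      simp at hval
      linarith
  · exfalso
    push Not at hin
    obtain ⟨t0, ht0⟩ := hin
    set σ : ℝ := ‖γ t0‖ ^ 2 with hσ
    have hWy : ∀ y : Esp n, ‖y‖ = ‖γ t0‖ → modW r d H y = (2 * hslope r d σ) • y := by
      intro y hy
      have : y ∉ tsupport H := fun h => by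
        have := mem_ball_zero_iff.1 (hsupp h)
        linarith
      unfold modW
      rw [grad_zero_of_notMem this, hy]; simp [hσ]
    have hrot := rot_unique hV hode t0 (2 * hslope r d σ) (fun y hy => by
      rw [hWy y hy]; ext i; simp; ring)
    have hne : γ t0 ≠ 0 := by
      intro h; rw [h, norm_zero] at ht0; linarith
    have hnorm : ∀ t, ‖γ t‖ = ‖γ t0‖ := fun t => by
      rw [show γ t = _ from hrot t, norm_smul, Complex.norm_exp_ofReal_mul_I, one_mul]
    obtain ⟨m, hm⟩ := rot_period (a := 2 * hslope r d σ) hne (by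
      have h1 := hrot (t0 + 1)
      have h2 := hper t0
      simp only [hγ] at h1 h2 ⊢
      rw [h2] at h1
      rw [show 2 * hslope r d σ * (t0 + 1 - t0) = 2 * hslope r d σ by ring] at h1
      exact h1.symm)
    have hm' : hslope r d σ = m * Real.pi := by linarith
    have e1 : ∀ u, (inner ℝ (modW r d H (f u)) (f u) : ℝ) = 2 * hslope r d σ * σ := by
      intro u
      obtain ⟨t, rfl⟩ := hsurj u
      have := hWy (γ t) (hnorm t)
      have h2 := hnorm t
      simp only [hγ] at this h2
      rw [this, real_inner_smul_left, real_inner_self_eq_norm_sq, h2]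
    have e2 : ∀ u, modG r d c H (f u) = c + prim (hslope r d) σ := by
      intro u
      obtain ⟨t, rfl⟩ := hsurj u
      have h2 : ‖f (t : UnitAddCircle)‖ = ‖γ t0‖ := hnorm t
      have h3 : f (t : UnitAddCircle) ∉ tsupport H := fun h => by
        have := mem_ball_zero_iff.1 (hsupp h)
        linarith
      unfold modG
      rw [image_eq_zero_of_notMem_tsupport h3, h2, sub_zero]
    simp only [e1, e2] at hval
    simp at hval
    have hg := prim_hslope_nonneg r d (s := σ) (by positivity)
    have hs0 := hslope_nonneg r d σ
    have hs1 := hslope_le r d σ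
    have hm0 : 0 ≤ m := by
      have : (-1:ℝ) < m := by nlinarith
      have : (-1:ℤ) < m := by exact_mod_cast this
      omega
    have hm1 : m ≤ 1 := by
      have : (m:ℝ) < 2 := by nlinarith
      have : m < 2 := by exact_mod_cast this
      omega
    interval_cases m
    · rw [hm'] at hval
      simp at hval
      linarith
    · rw [hm'] at hval
      have h5 : σ < r ^ 2 + d := by
        by_contra h
        have := hslope_top (r := r) hd (not_lt.1 h)
        rw [hm'] at this
        push_cast at this
        linarith
      have h6 : Real.pi * σ < c := by rw [← hdc]; gcongr
      push_cast at hval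
      linarith

end

section
open MeasureTheory AddCircle Filter


/-- Bump profile for the extremal radial Hamiltonian. -/
def bprof (r d m : ℝ) (s : ℝ) : ℝ :=
  m * (Real.smoothTransition ((s - d) / d) * Real.smoothTransition ((r ^ 2 - d - s) / d))

lemma bprof_smooth (r d m : ℝ) : ContDiff ℝ (⊤ : ℕ∞) (bprof r d m) := by
  unfold bprof
  refine contDiff_const.mul ((Real.smoothTransition.contDiff.comp ?_).mul (Real.smoothTransition.contDiff.comp ?_))
  · fun_prop
  · fun_prop

lemma bprof_zero_left {r d m s : ℝ} (hd : 0 < d) (h : s ≤ d) : bprof r d m s = 0 := by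
  unfold bprof
  rw [Real.smoothTransition.zero_of_nonpos (div_nonpos_of_nonpos_of_nonneg (by linarith) hd.le)]
  simp

lemma bprof_zero_right {r d m s : ℝ} (hd : 0 < d) (h : r ^ 2 - d ≤ s) : bprof r d m s = 0 := by
  unfold bprof
  rw [Real.smoothTransition.zero_of_nonpos (x := (r ^ 2 - d - s) / d)
    (div_nonpos_of_nonpos_of_nonneg (by linarith) hd.le)]
  simp

lemma bprof_mid {r d m s : ℝ} (hd : 0 < d) (h : 2 * d ≤ s) (h' : s ≤ r ^ 2 - 2 * d) : bprof r d m s = m := by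
  unfold bprof
  rw [Real.smoothTransition.one_of_one_le, Real.smoothTransition.one_of_one_le]
  · simp
  · rw [le_div_iff₀ hd]; linarith
  · rw [le_div_iff₀ hd]; linarith

lemma bprof_nonneg (r d s : ℝ) {m : ℝ} (hm : 0 ≤ m) : 0 ≤ bprof r d m s := by
  have h1 := Real.smoothTransition.nonneg ((s - d) / d)
  have h2 := Real.smoothTransition.nonneg ((r ^ 2 - d - s) / d)
  unfold bprof; positivity

lemma bprof_le (r d s : ℝ) {m : ℝ} (hm : 0 ≤ m) : bprof r d m s ≤ m := by
  have h1 := Real.smoothTransition.nonneg ((s - d) / d)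
  have h2 := Real.smoothTransition.nonneg ((r ^ 2 - d - s) / d)
  have h3 := Real.smoothTransition.le_one ((s - d) / d)
  have h4 := Real.smoothTransition.le_one ((r ^ 2 - d - s) / d)
  unfold bprof
  exact mul_le_of_le_one_right hm (mul_le_one₀ h3 h2 h4)

lemma prim_diff_const {χ : ℝ → ℝ} (hc : Continuous χ) {a b v : ℝ} (hab : a ≤ b) (h : ∀ s, a ≤ s → s ≤ b → χ s = v) :
    prim χ b - prim χ a = v * (b - a) := by
  have h1 : prim χ b - prim χ a = ∫ u in a..b, χ u :=
    intervalIntegral.integral_interval_sub_left (hc.intervalIntegrable _ _) (hc.intervalIntegrable _ _)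
  rw [h1, intervalIntegral.integral_congr (g := fun _ => v)]
  · rw [intervalIntegral.integral_const, smul_eq_mul, mul_comm]
  · intro u hu
    rw [uIcc_of_le hab] at hu
    exact h u hu.1 hu.2

/-- The extremal Hamiltonian. -/
def exH (r d m : ℝ) (x : Esp n) : ℝ := prim (bprof r d m) (r ^ 2) - prim (bprof r d m) (‖x‖ ^ 2)

lemma exH_grad (r d m : ℝ) (x : Esp n) :
    gradient (exH r d m) x = (-2 * bprof r d m (‖x‖ ^ 2)) • x := by
  apply HasGradientAt.gradient
  have h2 := rad_grad (bprof_smooth r d m).continuous x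
  rw [hasGradientAt_iff_hasFDerivAt] at *
  refine (h2.const_sub (prim (bprof r d m) (r ^ 2))).congr_fderiv ?_
  simp

lemma exH_zero (r d m : ℝ) : exH r d m (0 : Esp n) = prim (bprof r d m) (r ^ 2) := by
  simp [exH, prim_zero]

lemma exH_mem {r d m : ℝ} (hr : 0 < r) (hd : 0 < d) (hdr : 4 * d < r ^ 2) (hm : 0 ≤ m) :
    InHclass (ball (0 : Esp n) r) {0} (exH r d m) := by
  have hc := (bprof_smooth r d m).continuous
  have hsub : tsupport (exH r d m : Esp n → ℝ) ⊆ closedBall 0 (Real.sqrt (r ^ 2 - d)) := by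
    refine closure_minimal (fun x hx => ?_) isClosed_closedBall
    by_contra h
    rw [mem_closedBall_zero_iff, not_le] at h
    have h1 : r ^ 2 - d < ‖x‖ ^ 2 := (Real.sqrt_lt' ((Real.sqrt_nonneg _).trans_lt h)).1 h
    apply hx
    have e1 := prim_diff_const hc (a := r ^ 2 - d) (b := r ^ 2) (v := 0) (by linarith)
      (fun s hs _ => bprof_zero_right hd hs)
    have e2 := prim_diff_const hc (a := r ^ 2 - d) (b := ‖x‖ ^ 2) (v := 0) h1.le
      (fun s hs _ => bprof_zero_right hd hs)
    unfold exH
    linarith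
  refine ⟨?_, ?_, hsub.trans ?_, ⟨ball 0 (Real.sqrt d), isOpen_ball, ?_, prim (bprof r d m) (r ^ 2), fun x hx => ?_⟩, ?_⟩
  · exact contDiff_const.sub (rad_smooth (prim_contDiff (bprof_smooth r d m)))
  · exact (isCompact_closedBall _ _).of_isClosed_subset (isClosed_tsupport _) hsub
  · refine closedBall_subset_ball ?_
    rw [Real.sqrt_lt' hr]; linarith
  · rw [singleton_subset_iff]
    exact mem_ball_self (Real.sqrt_pos.2 hd)
  · rw [mem_ball_zero_iff, Real.lt_sqrt (norm_nonneg _)] at hx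
    have e1 := prim_diff_const hc (a := 0) (b := ‖x‖ ^ 2) (v := 0) (by positivity)
      (fun s _ hs => bprof_zero_left hd (hs.trans hx.le))
    rw [prim_zero] at e1
    unfold exH
    linarith
  · rintro z rfl x
    rw [exH_zero]
    have := prim_mono hc (fun s => bprof_nonneg r d s hm) (sq_nonneg ‖x‖)
    rw [prim_zero] at this
    unfold exH
    linarith

lemma exH_val {r d m : ℝ} (hd : 0 < d) (hdr : 4 * d < r ^ 2) (hm : 0 ≤ m) :
    m * (r ^ 2 - 4 * d) ≤ exH r d m (0 : Esp n) := by
  have hc := (bprof_smooth r d m).continuous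
  rw [exH_zero]
  have hmo := prim_mono hc (fun s => bprof_nonneg r d s hm)
  have h1 := hmo (show (0:ℝ) ≤ 2 * d by linarith)
  have h2 := hmo (show r ^ 2 - 2 * d ≤ r ^ 2 by linarith)
  rw [prim_zero] at h1
  have e1 := prim_diff_const hc (a := 2 * d) (b := r ^ 2 - 2 * d) (v := m) (by linarith)
    (fun s hs hs' => bprof_mid hd hs hs')
  have : m * (r ^ 2 - 2 * d - 2 * d) = m * (r ^ 2 - 4 * d) := by ring
  linarith

lemma exH_slow {r d m : ℝ} (hd : 0 < d) (hm : 0 ≤ m) (hmp : m < Real.pi) : ¬ HasFastOrbit (exH r d m : Esp n → ℝ) := by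
  rintro ⟨γ, T, ⟨hT, hode, hper, t₀, t₁, hne⟩, hT1⟩
  have hpi := Real.pi_pos
  have hVeq : ∀ x : Esp n, hamVF (exH r d m) x = (((-2 * bprof r d m (‖x‖ ^ 2) : ℝ) : ℂ) * Complex.I) • x := by
    intro x
    unfold hamVF
    rw [exH_grad]; ext i; simp; ring
  have hsm : ContDiff ℝ (⊤ : ℕ∞) (gradient (exH r d m : Esp n → ℝ)) :=
    grad_smooth (contDiff_const.sub (rad_smooth (prim_contDiff (bprof_smooth r d m))))
  have hsup : HasCompactSupport (gradient (exH r d m : Esp n → ℝ)) := by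
    refine HasCompactSupport.intro (isCompact_closedBall (0 : Esp n) (Real.sqrt (r ^ 2 - d))) fun x hx => ?_
    rw [mem_closedBall_zero_iff, not_le] at hx
    have h1 : r ^ 2 - d < ‖x‖ ^ 2 := (Real.sqrt_lt' ((Real.sqrt_nonneg _).trans_lt hx)).1 hx
    rw [exH_grad, bprof_zero_right hd h1.le]; simp
  obtain ⟨K, hK⟩ := hsm.lipschitzWith_of_hasCompactSupport hsup (by simp)
  have hV : LipschitzWith K (hamVF (exH r d m : Esp n → ℝ)) := by
    refine LipschitzWith.of_dist_le_mul fun x y => ?_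
    unfold hamVF
    rw [dist_eq_norm, ← smul_sub, norm_smul, Complex.norm_I, one_mul, ← dist_eq_norm]
    exact hK.dist_le_mul x y
  have hrot := rot_unique hV hode t₀ (-2 * bprof r d m (‖γ t₀‖ ^ 2)) (fun y hy => by rw [hVeq, hy])
  by_cases h0 : γ t₀ = 0
  · apply hne
    rw [hrot t₁, h0, smul_zero]
  · obtain ⟨k, hk⟩ := rot_period h0 (a := -2 * bprof r d m (‖γ t₀‖ ^ 2) * T) (by
      have h1 := hrot (t₀ + T)
      rw [hper, add_sub_cancel_left] at h1
      exact h1.symm)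
    have hb0 := bprof_nonneg r d (‖γ t₀‖ ^ 2) hm
    have hb1 := bprof_le r d (‖γ t₀‖ ^ 2) hm
    have hb2 : bprof r d m (‖γ t₀‖ ^ 2) * T ≤ m := (mul_le_of_le_one_right hb0 hT1).trans hb1
    have hb3 : 0 ≤ bprof r d m (‖γ t₀‖ ^ 2) * T := by positivity
    have hk0 : k ≤ 0 := by
      have : (k:ℝ) < 1 := by nlinarith
      have : k < 1 := by exact_mod_cast this
      omega
    have hk1 : 0 ≤ k := by
      have : (-1:ℝ) < k := by nlinarith
      have : (-1:ℤ) < k := by exact_mod_cast this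
      omega
    have hk2 : k = 0 := le_antisymm hk0 hk1
    rw [hk2] at hk
    have hb : bprof r d m (‖γ t₀‖ ^ 2) = 0 := by
      have : bprof r d m (‖γ t₀‖ ^ 2) * T = 0 := by push_cast at hk; linarith
      exact (mul_eq_zero.1 this).resolve_right hT.ne'
    apply hne
    rw [hrot t₁, hb]; simp

theorem final (n : ℕ) (hn : 1 ≤ n) (r : ℝ) (hr : 0 < r) :
    relCap (ball (0 : Esp n) r) {(0 : Esp n)} = ENNReal.ofReal (Real.pi * r ^ 2) := by
  apply le_antisymm
  · refine sSup_le ?_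
    rintro c ⟨H, hH, hslow, z, hz, rfl⟩
    rw [mem_singleton_iff.1 hz]
    apply ENNReal.ofReal_le_ofReal
    by_contra h
    exact hslow (upper_key hn hr hH (not_le.1 h))
  · refine le_of_forall_lt fun b hb => ?_
    have hb' : b.toReal < Real.pi * r ^ 2 := (ENNReal.lt_ofReal_iff_toReal_lt (ne_top_of_lt hb)).1 hb
    have hlim : Tendsto (fun e : ℝ => (Real.pi - e) * (r ^ 2 - 4 * e)) (𝓝[>] 0) (𝓝 (Real.pi * r ^ 2)) := by
      have hc : Continuous fun e : ℝ => (Real.pi - e) * (r ^ 2 - 4 * e) := by fun_prop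
      have := hc.tendsto 0
      simp only [sub_zero, mul_zero] at this
      exact this.mono_left nhdsWithin_le_nhds
    have h2 : ∀ᶠ e : ℝ in 𝓝[>] 0, e < Real.pi := nhdsWithin_le_nhds (gt_mem_nhds Real.pi_pos)
    have h3 : ∀ᶠ e : ℝ in 𝓝[>] 0, e < r ^ 2 / 4 := nhdsWithin_le_nhds (gt_mem_nhds (by positivity))
    obtain ⟨e, he1, he2, he3, he0⟩ := ((hlim.eventually (lt_mem_nhds hb')).and (h2.and (h3.and self_mem_nhdsWithin))).exists
    have he0' : 0 < e := he0
    refine lt_of_lt_of_le ?_ (le_sSup ⟨exH r e (Real.pi - e), exH_mem hr he0' (by linarith) (by linarith),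
      exH_slow he0' (by linarith) (by linarith), 0, rfl, rfl⟩)
    rw [ENNReal.lt_ofReal_iff_toReal_lt (ne_top_of_lt hb)]
    exact he1.trans_le (exH_val he0' (by linarith) (by linarith))

end

/-- **Normalization (Theorem 2.9(4) of Ginzburg–Gürel) for `M = {0} ⊂ ℝ^{2n}`**:
the relative Hofer–Zehnder capacity of the ball `B_r` relative to the origin is
`π r²`. -/
theorem stmt_5 (n : ℕ) (hn : 1 ≤ n) (r : ℝ) (hr : 0 < r) :
    relCap (ball (0 : Esp n) r) {(0 : Esp n)} =
      ENNReal.ofReal (Real.pi * r ^ 2) := by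
  exact final n hn r hr
end
end

section
/- Let n ≥ 1, let V ⊆ ℝ^{2n} be open, and let Z ⊂ V be nonempty and compact with c_HZ(V,Z) < ∞. Let H : V → ℝ be a proper smooth function that is constant on Z and satisfies H|_Z = min H. Then the set of values c ∈ ℝ for which the level set H⁻¹(c) is nonempty but contains no nonconstant periodic orbit of the Hamiltonian flow of H (no nonconstant periodic solution of γ'(t) = J∇H(γ(t)) with image in H⁻¹(c)) has Lebesgue measure zero. -/
open scoped RealInnerProductSpace ENNReal NNReal Topology
open Metric Set

noncomputable section

variable {n : ℕ}

universe u

theorem mvt_step {E F : Type*} [NormedAddCommGroup E] [NormedSpace ℝ E]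
    [NormedAddCommGroup F] [NormedSpace ℝ F] (f : E → F) (B : Set E) (hB : Convex ℝ B)
    (hf : ∀ z ∈ B, DifferentiableAt ℝ f z) (M : ℝ) (k : ℕ) (x : E) (hx : x ∈ B) (hM : 0 ≤ M)
    (hb : ∀ z ∈ B, ‖fderiv ℝ f z‖ ≤ M * ‖z - x‖ ^ k) (y : E) (hy : y ∈ B) :
    ‖f y - f x‖ ≤ M * ‖y - x‖ ^ (k + 1) := by
  have hc : Convex ℝ (B ∩ closedBall x ‖y - x‖) := hB.inter (convex_closedBall _ _)
  have h := hc.norm_image_sub_le_of_norm_fderiv_le (𝕜 := ℝ) (f := f) (C := M * ‖y - x‖ ^ k)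
    (fun z hz => hf z hz.1) (fun z hz => (hb z hz.1).trans ?_)
    (x := x) (y := y) ⟨hx, by simp⟩ ⟨hy, by simp [dist_eq_norm]⟩
  · calc _ ≤ _ := h
      _ = _ := by ring
  · have : ‖z - x‖ ≤ ‖y - x‖ := by simpa [dist_eq_norm] using hz.2
    gcongr

theorem taylor_bound {E : Type u} [NormedAddCommGroup E] [NormedSpace ℝ E] (B : Set E)
    (hB : Convex ℝ B) (M : ℝ) (hM : 0 ≤ M) (x : E) (hx : x ∈ B) (k : ℕ) :
    ∀ {F : Type u} [NormedAddCommGroup F] [NormedSpace ℝ F] (f : E → F),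
      (∀ z ∈ B, ContDiffAt ℝ k f z) → (∀ z ∈ B, ‖iteratedFDeriv ℝ k f z‖ ≤ M) →
      (∀ j < k, iteratedFDeriv ℝ j f x = 0) → ∀ y ∈ B, ‖f y‖ ≤ M * ‖y - x‖ ^ k := by
  induction k with
  | zero =>
    intro F _ _ f _ hb _ y hy
    simpa using hb y hy
  | succ k ih =>
    intro F _ _ f hf hb h0 y hy
    have h1 : ∀ z ∈ B, ‖fderiv ℝ f z‖ ≤ M * ‖z - x‖ ^ k := by
      apply ih (fderiv ℝ f)
      · intro z hz
        exact (hf z hz).fderiv_right (by norm_cast)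
      · intro z hz
        rw [norm_iteratedFDeriv_fderiv]; exact hb z hz
      · intro j hj
        have := h0 (j+1) (by omega)
        rw [← norm_eq_zero, norm_iteratedFDeriv_fderiv, this, norm_zero]
    have h2 := mvt_step f B hB (fun z hz => (hf z hz).differentiableAt (by simp)) M k x hx hM h1 y hy
    have h3 : f x = 0 := by
      have := h0 0 (by omega)
      rw [← norm_eq_zero, norm_iteratedFDeriv_zero] at this
      simpa using this
    simpa [h3] using h2

theorem null_of_locally_null {E : Type*} [TopologicalSpace E] [SecondCountableTopology E]
    (f : E → ℝ) (s : Set E)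
    (h : ∀ x ∈ s, ∃ u ∈ 𝓝[s] x, MeasureTheory.volume (f '' u) = 0) :
    MeasureTheory.volume (f '' s) = 0 := by
  choose! u hu h0 using h
  obtain ⟨t, hts, htc, hst⟩ := TopologicalSpace.countable_cover_nhdsWithin hu
  refine MeasureTheory.measure_mono_null (image_mono hst) ?_
  rw [image_iUnion₂]
  exact (MeasureTheory.measure_biUnion_null_iff htc).2 (fun x hx => h0 x (hts hx))

theorem sard_flat {E : Type u} [NormedAddCommGroup E] [NormedSpace ℝ E] [FiniteDimensional ℝ E]
    (f : E → ℝ) (s : Set E) (N : ℕ) (hN : Module.finrank ℝ E = N)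
    (hf : ∀ x ∈ s, ContDiffAt ℝ (N + 1 : ℕ) f x)
    (h0 : ∀ x ∈ s, ∀ j, 1 ≤ j → j ≤ N → iteratedFDeriv ℝ j f x = 0) :
    MeasureTheory.volume (f '' s) = 0 := by
  let _ : MeasurableSpace E := borel E
  have : BorelSpace E := ⟨rfl⟩
  have : SecondCountableTopology E := by
      have := FiniteDimensional.proper_real E
      infer_instance
  apply null_of_locally_null
  intro x hx
  have h1 : ∀ᶠ y in 𝓝 x, ContDiffAt ℝ (N + 1 : ℕ) f y := (hf x hx).eventually (by simp)
  have h2 : ContinuousAt (iteratedFDeriv ℝ (N + 1) f) x :=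
    ((hf x hx).iteratedFDeriv_right (i := N + 1) (m := 0) (by simp)).continuousAt
  have h3 : ∀ᶠ y in 𝓝 x, ‖iteratedFDeriv ℝ (N + 1) f y‖ < ‖iteratedFDeriv ℝ (N + 1) f x‖ + 1 :=
    h2.norm.eventually_lt continuousAt_const (by simp)
  obtain ⟨ε, hε, hball⟩ := Metric.eventually_nhds_iff_ball.1 (h1.and h3)
  set M : ℝ≥0 := ‖iteratedFDeriv ℝ (N + 1) f x‖₊ + 1
  refine ⟨s ∩ ball x ε, inter_mem_nhdsWithin s (ball_mem_nhds x hε), ?_⟩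
  have hol : HolderOnWith M (N + 1 : ℕ) f (s ∩ ball x ε) := by
    intro a ha b hb
    have key : ‖f b - f a‖ ≤ M * ‖b - a‖ ^ (N + 1) := by
      refine mvt_step f (ball x ε) (convex_ball _ _)
        (fun z hz => (hball z hz).1.differentiableAt (by simp)) M N a ha.2 M.2 ?_ b hb.2
      refine taylor_bound (ball x ε) (convex_ball _ _) M M.2 a ha.2 N (fderiv ℝ f) ?_ ?_ ?_
      · intro z hz
        exact (hball z hz).1.fderiv_right (by norm_cast)
      · intro z hz
        rw [norm_iteratedFDeriv_fderiv]
        exact (hball z hz).2.le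
      · intro j hj
        rw [← norm_eq_zero, norm_iteratedFDeriv_fderiv, h0 a ha.1 (j+1) (by omega) (by omega),
          norm_zero]
    rw [edist_comm (f a), edist_comm a, edist_eq_enorm_sub, edist_eq_enorm_sub]
    have : ‖f b - f a‖₊ ≤ M * ‖b - a‖₊ ^ (N + 1) := by exact_mod_cast key
    simp only [enorm_eq_nnnorm]
    rw [NNReal.coe_natCast, ENNReal.rpow_natCast]
    exact_mod_cast this
  have := hol.hausdorffMeasure_image_le (by positivity) (d := 1) zero_le_one
  rw [MeasureTheory.hausdorffMeasure_real] at this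
  rw [Real.hausdorffMeasure_of_finrank_lt (by rw [hN]; push_cast; linarith)] at this
  simpa using this

theorem sard_aux (N : ℕ) : ∀ {E : Type u} [NormedAddCommGroup E] [NormedSpace ℝ E]
    [FiniteDimensional ℝ E], Module.finrank ℝ E = N → ∀ (f : E → ℝ) (s : Set E),
    (∀ x ∈ s, ContDiffAt ℝ ((N + 1) ^ 2 : ℕ) f x) → (∀ x ∈ s, fderiv ℝ f x = 0) →
    MeasureTheory.volume (f '' s) = 0 := by
  induction N with
  | zero =>
    intro E _ _ _ hN f s hf h0
    exact sard_flat f s 0 hN (fun x hx => by simpa using hf x hx) (fun x hx j h1 h2 => by omega)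
  | succ N ih =>
    intro E _ _ _ hN f s hf h0
    have : SecondCountableTopology E := by
      have := FiniteDimensional.proper_real E
      infer_instance
    have : CompleteSpace E := FiniteDimensional.complete ℝ E
    let flat : Set E := {x ∈ s | ∀ j, 1 ≤ j → j ≤ N + 1 → iteratedFDeriv ℝ j f x = 0}
    let S : ℕ → Set E := fun k =>
      {x ∈ s | k ≤ N ∧ iteratedFDeriv ℝ k f x = 0 ∧ iteratedFDeriv ℝ (k+1) f x ≠ 0}
    have hcov : s ⊆ flat ∪ ⋃ k, S k := by
      intro x hx
      by_cases hfl : ∀ j, 1 ≤ j → j ≤ N + 1 → iteratedFDeriv ℝ j f x = 0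
      · exact Or.inl ⟨hx, hfl⟩
      · right
        push Not at hfl
        classical
        have hsp := Nat.find_spec hfl
        have hmin := fun m => Nat.find_min hfl (m := m)
        set j := Nat.find hfl
        have hj1 : j ≠ 1 := by
          intro h
          apply hsp.2.2
          rw [h, ← norm_eq_zero, ← zero_add 1, ← norm_iteratedFDeriv_fderiv,
            norm_iteratedFDeriv_zero, h0 x hx, norm_zero]
        refine mem_iUnion.2 ⟨j - 1, hx, by omega, ?_, ?_⟩
        · by_contra hne
          exact hmin (j - 1) (by omega) ⟨by omega, by omega, hne⟩
        · have : j - 1 + 1 = j := by omega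
          rw [this]; exact hsp.2.2
    refine MeasureTheory.measure_mono_null (image_mono hcov) ?_
    rw [image_union, image_iUnion, MeasureTheory.measure_union_null_iff]
    constructor
    · refine sard_flat f flat (N+1) hN (fun x hx => (hf x hx.1).of_le ?_) (fun x hx => hx.2)
      norm_cast; nlinarith
    rw [MeasureTheory.measure_iUnion_null_iff]
    intro k
    apply null_of_locally_null
    rintro x hxS
    have ⟨hx, hk, hx0, hx1⟩ := hxS
    have hgc : ContDiffAt ℝ ((N + 1) ^ 2 : ℕ) (iteratedFDeriv ℝ k f) x :=
      (hf x hx).iteratedFDeriv_right (by norm_cast; nlinarith)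
    have hgd : DifferentiableAt ℝ (iteratedFDeriv ℝ k f) x := hgc.differentiableAt (by simp)
    have hg1 : fderiv ℝ (iteratedFDeriv ℝ k f) x ≠ 0 := by
      intro h
      apply hx1
      rw [← norm_eq_zero, ← norm_fderiv_iteratedFDeriv, h]
      exact norm_zero (E := E →L[ℝ] E [×k]→L[ℝ] ℝ)
    obtain ⟨v, hv⟩ : ∃ v, fderiv ℝ (iteratedFDeriv ℝ k f) x v ≠ 0 := by
      by_contra! h
      exact hg1 (ContinuousLinearMap.ext h)
    obtain ⟨m, hm⟩ : ∃ m, fderiv ℝ (iteratedFDeriv ℝ k f) x v m ≠ 0 := by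
      by_contra! h
      exact hv (ContinuousMultilinearMap.ext h)
    let ev := ContinuousMultilinearMap.apply ℝ (fun _ : Fin k => E) ℝ m
    let w : E → ℝ := fun y => ev (iteratedFDeriv ℝ k f y)
    have hwc : ContDiffAt ℝ ((N + 1) ^ 2 : ℕ) w x := ev.contDiff.contDiffAt.comp x hgc
    set w' := fderiv ℝ w x with hw'
    have hws : HasStrictFDerivAt w w' x := hwc.hasStrictFDerivAt (by simp)
    have hw0 : w' ≠ 0 := by
      intro h
      have : w' = ev.comp (fderiv ℝ (iteratedFDeriv ℝ k f) x) :=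
        (ev.hasFDerivAt.comp x hgd.hasFDerivAt).fderiv
      apply hm
      have h2 : w' v = 0 := by rw [h]; rfl
      rw [this] at h2
      exact h2
    have hrange : w'.range = ⊤ := LinearMap.range_eq_top.2
      (LinearMap.surjective (f := (w' : E →ₗ[ℝ] ℝ)) (by
        intro h; exact hw0 (ContinuousLinearMap.coe_injective h)))
    have hker : Module.finrank ℝ w'.ker = N := by
      have := LinearMap.finrank_range_add_finrank_ker (w' : E →ₗ[ℝ] ℝ)
      have h2 : Module.finrank ℝ (w' : E →ₗ[ℝ] ℝ).range = 1 := by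
        rw [hrange]; simp
      rw [h2, hN] at this
      have h3 : Module.finrank ℝ (w' : E →ₗ[ℝ] ℝ).ker = N := by omega
      exact h3
    let φ := hws.implicitFunctionDataOfComplemented w w' hrange
      w'.ker_closedComplemented_of_finiteDimensional_range
    have hφl : φ.leftFun = w := rfl
    have hφp : φ.pt = x := rfl
    have hr : ContDiff ℝ ((N + 1) ^ 2 : ℕ) φ.rightFun := by
      have : φ.rightFun = fun y => φ.rightDeriv (y - x) := rfl
      rw [this]
      exact (ContinuousLinearMap.contDiff _).comp (contDiff_id.sub contDiff_const)
    have hψu := φ.contDiffAt_implicitFunction (n := ((N + 1) ^ 2 : ℕ)) hwc hr.contDiffAt (by simp)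
    have hwx : w x = 0 := by simp [w, ev, hx0]
    let ψ : w'.ker → E := fun z => φ.implicitFunction 0 z
    have hψ : ContDiffAt ℝ ((N + 1) ^ 2 : ℕ) ψ (φ.rightFun x) := by
      have : ψ = φ.implicitFunction.uncurry ∘ (fun z => ((0 : ℝ), z)) := rfl
      rw [this]
      refine ContDiffAt.comp _ ?_ (contDiffAt_const.prodMk contDiffAt_id)
      have h2 : φ.prodFun φ.pt = (0, φ.rightFun x) := by
        rw [φ.prodFun_apply, hφl, hφp, hwx]
      rwa [h2] at hψu
    have hψe : ∀ᶠ y in 𝓝 x, ContDiffAt ℝ ((N + 1) ^ 2 : ℕ) ψ (φ.rightFun y) :=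
      hr.continuous.continuousAt.eventually (hψ.eventually (ENat.natCast_ne_coe_top _))
    have himp : ∀ᶠ y in 𝓝 x, φ.implicitFunction (w y) (φ.rightFun y) = y :=
      φ.implicitFunction_apply_image
    refine ⟨{y | y ∈ S k ∧ (ContDiffAt ℝ ((N + 1) ^ 2 : ℕ) ψ (φ.rightFun y) ∧
      φ.implicitFunction (w y) (φ.rightFun y) = y)},
      Filter.inter_mem self_mem_nhdsWithin (mem_nhdsWithin_of_mem_nhds (hψe.and himp)), ?_⟩
    have hfin := ih hker (f ∘ ψ) {z | ContDiffAt ℝ ((N + 1) ^ 2 : ℕ) ψ z ∧ ψ z ∈ s} ?_ ?_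
    · refine MeasureTheory.measure_mono_null ?_ hfin
      rintro _ ⟨y, ⟨hyS, hy1, hy2⟩, rfl⟩
      have hwy : w y = 0 := by simp [w, ev, hyS.2.2.1]
      have hψy : ψ (φ.rightFun y) = y := by
        rw [hwy] at hy2; exact hy2
      refine ⟨φ.rightFun y, ⟨hy1, ?_⟩, ?_⟩
      · rw [hψy]; exact hyS.1
      · simp only [Function.comp, hψy]
    · rintro z ⟨hz1, hz2⟩
      exact ((hf _ hz2).of_le (by norm_cast; nlinarith)).comp z hz1
    · rintro z ⟨hz1, hz2⟩
      have h1 : DifferentiableAt ℝ f (ψ z) := (hf _ hz2).differentiableAt (by simp)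
      rw [fderiv_comp z h1 (hz1.differentiableAt (by simp)), h0 _ hz2]
      simp


theorem hamVF_dist (H H' : Esp n → ℝ) (x y : Esp n) :
    dist (hamVF H x) (hamVF H' y) = dist (fderiv ℝ H x) (fderiv ℝ H' y) := by
  unfold hamVF gradient
  rw [dist_eq_norm, ← smul_sub, norm_smul, Complex.norm_I, one_mul, ← map_sub,
    LinearIsometryEquiv.norm_map, dist_eq_norm]

theorem hamVF_eq_zero_iff (H : Esp n → ℝ) (x : Esp n) : hamVF H x = 0 ↔ fderiv ℝ H x = 0 := by
  unfold hamVF gradient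
  rw [smul_eq_zero_iff_right Complex.I_ne_zero, LinearIsometryEquiv.map_eq_zero_iff]

theorem hamVF_smul (H H' : Esp n → ℝ) (x : Esp n) (a : ℝ)
    (h : fderiv ℝ H' x = a • fderiv ℝ H x) : hamVF H' x = a • hamVF H x := by
  unfold hamVF gradient
  rw [h, map_smulₛₗ, smul_comm]
  rfl

theorem fderiv_hamVF (H : Esp n → ℝ) (x : Esp n) : fderiv ℝ H x (hamVF H x) = 0 := by
  have h : fderiv ℝ H x (hamVF H x) = ⟪gradient H x, hamVF H x⟫ := by
    rw [gradient, InnerProductSpace.toDual_symm_apply]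
  rw [h, hamVF]
  rw [PiLp.inner_apply]
  refine Finset.sum_eq_zero fun i _ => ?_
  rw [Complex.inner]
  simp
  ring

theorem gronwall_orbits {E : Type*} [NormedAddCommGroup E] [NormedSpace ℝ E] (X : E → E)
    (K : Set E) (L : ℝ≥0) (hL : LipschitzOnWith L X K) (γ η : ℝ → E)
    (hγ : ∀ t, HasDerivAt γ (X (γ t)) t) (hη : ∀ t, HasDerivAt η (X (η t)) t)
    (hγK : ∀ t, γ t ∈ K) (hηK : ∀ t, η t ∈ K) (t : ℝ) :
    dist (γ t) (η t) ≤ dist (γ 0) (η 0) * Real.exp (L * |t|) := by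
  rcases le_total 0 t with ht | ht
  · have := dist_le_of_trajectories_ODE_of_mem (v := fun _ => X) (s := fun _ => K) (K := L)
      (f := γ) (g := η) (a := 0) (b := t) (δ := dist (γ 0) (η 0)) (fun _ _ => hL)
      (fun s _ => (hγ s).continuousAt.continuousWithinAt) (fun s _ => (hγ s).hasDerivWithinAt)
      (fun s _ => hγK s)
      (fun s _ => (hη s).continuousAt.continuousWithinAt) (fun s _ => (hη s).hasDerivWithinAt)
      (fun s _ => hηK s) le_rfl t ⟨ht, le_rfl⟩
    simpa [abs_of_nonneg ht] using this
  · have h1 : ∀ s, HasDerivAt (fun s => γ (-s)) (-X (γ (-s))) s := fun s => by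
      simpa [Function.comp_def] using (hγ (-s)).scomp s (hasDerivAt_neg s)
    have h2 : ∀ s, HasDerivAt (fun s => η (-s)) (-X (η (-s))) s := fun s => by
      simpa [Function.comp_def] using (hη (-s)).scomp s (hasDerivAt_neg s)
    have := dist_le_of_trajectories_ODE_of_mem (v := fun _ x => - X x) (s := fun _ => K) (K := L)
      (f := fun s => γ (-s)) (g := fun s => η (-s)) (a := 0) (b := -t) (δ := dist (γ 0) (η 0))
      (fun _ _ => hL.neg)
      (fun s _ => (h1 s).continuousAt.continuousWithinAt) (fun s _ => (h1 s).hasDerivWithinAt)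
      (fun s _ => hγK _)
      (fun s _ => (h2 s).continuousAt.continuousWithinAt) (fun s _ => (h2 s).hasDerivWithinAt)
      (fun s _ => hηK _) (by simp) (-t) ⟨by linarith, le_rfl⟩
    simpa [abs_of_nonpos ht] using this

theorem limit_orbits {E : Type*} [NormedAddCommGroup E] [NormedSpace ℝ E] (X : E → E)
    (K : Set E) (hK : IsCompact K) (L : ℝ≥0) (hL : LipschitzOnWith L X K) (γ : ℕ → ℝ → E)
    (hγ : ∀ k t, HasDerivAt (γ k) (X (γ k t)) t) (hγK : ∀ k t, γ k t ∈ K)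
    (T : ℕ → ℝ) (a b : ℝ) (hT : ∀ k, T k ∈ Icc a b) (hper : ∀ k t, γ k (t + T k) = γ k t) :
    ∃ (η : ℝ → E) (τ : ℝ) (φ : ℕ → ℕ), StrictMono φ ∧ τ ∈ Icc a b ∧
      (∀ t, HasDerivAt η (X (η t)) t) ∧ (∀ t, η t ∈ K) ∧ (∀ t, η (t + τ) = η t) ∧
      ∀ t, Filter.Tendsto (fun k => γ (φ k) t) Filter.atTop (𝓝 (η t)) := by
  obtain ⟨⟨x, τ⟩, hxτ, φ, hφ, hlim⟩ := (hK.prod (isCompact_Icc (a := a) (b := b))).tendsto_subseq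
    (x := fun k => (γ k 0, T k)) (fun k => ⟨hγK k 0, hT k⟩)
  have hx : Filter.Tendsto (fun k => γ (φ k) 0) Filter.atTop (𝓝 x) := hlim.fst_nhds
  have hτ : Filter.Tendsto (fun k => T (φ k)) Filter.atTop (𝓝 τ) := hlim.snd_nhds
  have hgr : ∀ j k t, dist (γ (φ j) t) (γ (φ k) t) ≤
      dist (γ (φ j) 0) (γ (φ k) 0) * Real.exp (L * |t|) := fun j k t =>
    gronwall_orbits X K L hL _ _ (hγ _) (hγ _) (hγK _) (hγK _) t
  have hex : ∀ t, ∃ y ∈ K, Filter.Tendsto (fun k => γ (φ k) t) Filter.atTop (𝓝 y) := by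
    intro t
    have hc : CauchySeq (fun k => γ (φ k) t) := by
      have h0 := hx.cauchySeq
      rw [Metric.cauchySeq_iff'] at h0 ⊢
      intro ε hε
      have he := Real.exp_pos (L * |t|)
      obtain ⟨N, hN⟩ := h0 (ε / Real.exp (L * |t|)) (by positivity)
      refine ⟨N, fun k hk => (hgr k N t).trans_lt ?_⟩
      have := hN k hk
      rwa [lt_div_iff₀ he] at this
    obtain ⟨y, hyK, hy⟩ := cauchySeq_tendsto_of_isComplete hK.isComplete
      (fun k => hγK (φ k) t) hc
    exact ⟨y, hyK, hy⟩
  choose η hηK hη using hex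
  have hη0 : η 0 = x := tendsto_nhds_unique (hη 0) hx
  have hd : ∀ k t, dist (γ (φ k) t) (η t) ≤ dist (γ (φ k) 0) x * Real.exp (L * |t|) := by
    intro k t
    refine le_of_tendsto_of_tendsto (tendsto_const_nhds.dist (hη t))
      ((tendsto_const_nhds.dist hx).mul_const _) (Filter.Eventually.of_forall fun j => hgr k j t)
  have hd0 : Filter.Tendsto (fun k => dist (γ (φ k) 0) x) Filter.atTop (𝓝 0) :=
    tendsto_iff_dist_tendsto_zero.1 hx
  have hder : ∀ t, HasDerivAt η (X (η t)) t := by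
    intro t
    refine hasDerivAt_of_tendstoLocallyUniformlyOn (l := Filter.atTop)
      (f := fun k => γ (φ k)) (f' := fun k t => X (γ (φ k) t)) (g' := fun t => X (η t))
      (s := ball (0 : ℝ) (|t| + 1)) isOpen_ball ?_ (Filter.Eventually.of_forall fun k s _ => hγ _ s)
      (fun s _ => hη s) (by simp)
    apply TendstoUniformlyOn.tendstoLocallyUniformlyOn
    rw [Metric.tendstoUniformlyOn_iff]
    intro ε hε
    have h1 : Filter.Tendsto
        (fun k => L * (dist (γ (φ k) 0) x * Real.exp (L * (|t| + 1)))) Filter.atTop (𝓝 0) := by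
      simpa using (hd0.mul_const (Real.exp (L * (|t| + 1)))).const_mul (L : ℝ)
    filter_upwards [h1.eventually_lt_const hε] with k hk s hs
    have hs' : |s| ≤ |t| + 1 := by
      have := mem_ball_zero_iff.1 hs
      exact this.le
    calc dist (X (η s)) (X (γ (φ k) s)) ≤ L * dist (η s) (γ (φ k) s) :=
          hL.dist_le_mul _ (hηK s) _ (hγK _ s)
      _ = L * dist (γ (φ k) s) (η s) := by rw [dist_comm]
      _ ≤ L * (dist (γ (φ k) 0) x * Real.exp (L * |s|)) := by
          gcongr
          exact hd k s
      _ ≤ L * (dist (γ (φ k) 0) x * Real.exp (L * (|t| + 1))) := by gcongr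
      _ < ε := hk
  refine ⟨η, τ, φ, hφ, hxτ.2, hder, hηK, fun t => ?_, hη⟩
  have h1 : Filter.Tendsto (fun k => γ (φ k) (t + T (φ k))) Filter.atTop (𝓝 (η t)) := by
    simp only [hper]
    exact hη t
  have h2 : Filter.Tendsto (fun k => η (t + T (φ k))) Filter.atTop (𝓝 (η (t + τ))) :=
    (hder (t + τ)).continuousAt.tendsto.comp (tendsto_const_nhds.add hτ)
  refine tendsto_nhds_unique ?_ h1
  refine (tendsto_iff_of_dist ?_).1 h2
  have h3 : Filter.Tendsto (fun k => dist (γ (φ k) 0) x * Real.exp (L * |t + T (φ k)|))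
      Filter.atTop (𝓝 (0 * Real.exp (L * |t + τ|))) := by
    refine hd0.mul ?_
    exact (Real.continuous_exp.tendsto _).comp
      (tendsto_const_nhds.mul ((tendsto_const_nhds.add hτ).abs))
  rw [zero_mul] at h3
  refine squeeze_zero (fun _ => dist_nonneg) (fun k => ?_) h3
  rw [dist_comm]
  exact hd k _


theorem fderiv_locLip (H : Esp n → ℝ) (K V : Set (Esp n)) (hV : IsOpen V) (hKV : K ⊆ V)
    (hK : IsCompact K) (hsm : ContDiffOn ℝ (⊤ : ℕ∞) H V) :
    ∃ L : ℝ≥0, LipschitzOnWith L (hamVF H) K := by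
  apply LocallyLipschitzOn.exists_lipschitzOnWith_of_compact hK
  intro x hx
  have h1 : ContDiffAt ℝ (⊤ : ℕ∞) H x := hsm.contDiffAt (hV.mem_nhds (hKV hx))
  have h2 : ContDiffAt ℝ 1 (fderiv ℝ H) x := h1.fderiv_right (by norm_cast)
  obtain ⟨L, t, ht, hL⟩ := h2.exists_lipschitzOnWith
  refine ⟨L, t, mem_nhdsWithin_of_mem_nhds ht, ?_⟩
  apply LipschitzOnWith.of_dist_le_mul
  intro y hy z hz
  rw [hamVF_dist]
  exact hL.dist_le_mul y hy z hz

theorem no_short_orbits_nearby (V : Set (Esp n)) (hV : IsOpen V) (H : Esp n → ℝ)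
    (hsm : ContDiffOn ℝ (⊤ : ℕ∞) H V)
    (hproper : ∀ s : Set ℝ, IsCompact s → IsCompact {x ∈ V | H x ∈ s})
    (c : ℝ) (hreg : ∀ x ∈ V, H x = c → fderiv ℝ H x ≠ 0)
    (hno : ¬ ∃ γ T, IsPeriodicOrbit H γ T ∧ ∀ t, γ t ∈ V ∧ H (γ t) = c) (T : ℝ) (hT : 0 < T) :
    ∀ᶠ c' in 𝓝 c, ¬ ∃ γ T', IsPeriodicOrbit H γ T' ∧ T' ≤ T ∧ ∀ t, γ t ∈ V ∧ H (γ t) = c' := by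
  by_contra hcon
  rw [Filter.not_eventually] at hcon
  simp only [not_not] at hcon
  obtain ⟨ns, hns, hor⟩ := Filter.exists_seq_forall_of_frequently hcon
  choose γ T' hγ hT' hlev using hor
  have hK := hproper _ hns.isCompact_insert_range
  set K := {x ∈ V | H x ∈ insert c (range ns)} with hKdef
  obtain ⟨L, hL⟩ := fderiv_locLip H K V hV (fun x hx => hx.1) hK hsm
  -- replace the periods by multiples lying in `[T, 2T]`
  have hmul : ∀ k, ∃ T'' ∈ Icc T (2 * T), ∀ t, γ k (t + T'') = γ k t := by
    intro k
    have hpos := (hγ k).1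
    have hp : Function.Periodic (γ k) (T' k) := (hγ k).2.2.1
    refine ⟨⌈T / T' k⌉₊ * T' k, ⟨?_, ?_⟩, hp.nat_mul _⟩
    · have := Nat.le_ceil (T / T' k)
      rwa [div_le_iff₀ hpos] at this
    · have := (Nat.ceil_lt_add_one (div_nonneg hT.le hpos.le)).le
      have h2 := mul_le_mul_of_nonneg_right this hpos.le
      have h3 : (T / T' k + 1) * T' k = T + T' k := by field_simp
      linarith [hT' k]
  choose T'' hT'' hper using hmul
  obtain ⟨η, τ, φ, hφ, hτ, hη, hηK, hηper, hlim⟩ := limit_orbits (hamVF H) K hK L hL γ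
    (fun k => (hγ k).2.1) (fun k t => ⟨(hlev k t).1, by rw [(hlev k t).2]; simp⟩) T'' T (2 * T)
    hT'' hper
  have hηc : ∀ t, H (η t) = c := by
    intro t
    have hcont : ContinuousAt H (η t) :=
      (hsm.contDiffAt (hV.mem_nhds (hηK t).1)).continuousAt
    have h1 := hcont.tendsto.comp (hlim t)
    have h2 : (H ∘ fun k => γ (φ k) t) = ns ∘ φ := by
      funext k
      exact (hlev (φ k) t).2
    rw [h2] at h1
    exact tendsto_nhds_unique h1 (hns.comp hφ.tendsto_atTop)
  refine hno ⟨η, τ, ⟨lt_of_lt_of_le hT hτ.1, hη, hηper, ?_⟩, fun t => ⟨(hηK t).1, hηc t⟩⟩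
  by_contra! hconst
  have h1 : η = fun _ => η 0 := funext fun t => hconst t 0
  have h2 : HasDerivAt η 0 0 := by
    rw [h1]; exact hasDerivAt_const _ _
  have h3 := (hη 0).unique h2
  rw [hamVF_eq_zero_iff] at h3
  exact hreg _ (hηK 0).1 (hηc 0) h3

theorem capacity_bound (V Z : Set (Esp n)) (hV : IsOpen V) (hZne : Z.Nonempty) (hZV : Z ⊆ V)
    (H : Esp n → ℝ) (hsm : ContDiffOn ℝ (⊤ : ℕ∞) H V)
    (hproper : ∀ s : Set ℝ, IsCompact s → IsCompact {x ∈ V | H x ∈ s})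
    (m : ℝ) (hconst : ∀ z ∈ Z, H z = m) (hmin : ∀ x ∈ V, m ≤ H x)
    (m₀ M : ℝ) (hm : m < m₀) (hM : m₀ ≤ M) (T : ℝ) (g : ℝ → ℝ) (hg : ContDiff ℝ (⊤ : ℕ∞) g)
    (hg0 : ∀ c, 0 ≤ g c) (hgT : ∀ c, g c ≤ T) (hgs : ∀ c, g c ≠ 0 → c ∈ Ioo m₀ M)
    (hor : ∀ c, g c ≠ 0 →
      ¬ ∃ γ T', IsPeriodicOrbit H γ T' ∧ T' ≤ T ∧ ∀ t, γ t ∈ V ∧ H (γ t) = c) :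
    ENNReal.ofReal (∫ c in m..M, g c) ≤ relCap V Z := by
  classical
  let F : ℝ → ℝ := fun c => ∫ s in c..M, g s
  have hgi : ∀ a b, IntervalIntegrable g MeasureTheory.volume a b := fun a b =>
    hg.continuous.intervalIntegrable a b
  have hF : ∀ c, HasDerivAt F (-g c) c := fun c =>
    intervalIntegral.integral_hasDerivAt_left (hgi c M)
      hg.continuous.stronglyMeasurable.stronglyMeasurableAtFilter hg.continuous.continuousAt
  have hFs : ContDiff ℝ (⊤ : ℕ∞) F := by
    rw [contDiff_infty_iff_deriv]
    refine ⟨fun c => (hF c).differentiableAt, ?_⟩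
    have : deriv F = fun c => -g c := funext fun c => (hF c).deriv
    rw [this]
    exact hg.neg
  have hFanti : Antitone F := antitone_of_deriv_nonpos (fun c => (hF c).differentiableAt)
    (fun c => by rw [(hF c).deriv]; linarith [hg0 c])
  have hFM : ∀ c, M ≤ c → F c = 0 := by
    intro c hc
    apply intervalIntegral.integral_zero_ae
    refine Filter.Eventually.of_forall fun s hs => ?_
    rw [uIoc_of_ge hc] at hs
    by_contra h
    exact absurd (hgs s h).2 (not_lt.2 hs.1.le)
  have hFm : ∀ c, c ≤ m₀ → F c = F m := by
    intro c hc
    have h1 : (∫ s in c..m, g s) + F m = F c :=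
      intervalIntegral.integral_add_adjacent_intervals (hgi _ _) (hgi _ _)
    have h2 : (∫ s in c..m, g s) = 0 := by
      apply intervalIntegral.integral_zero_ae
      refine Filter.Eventually.of_forall fun s hs => ?_
      have hs' : s ≤ m₀ := by
        have := hs.2
        exact this.trans (max_le hc hm.le)
      by_contra h
      exact absurd (hgs s h).1 (not_lt.2 hs')
    linarith
  have hFpos : ∀ c, 0 ≤ F c := by
    intro c
    rw [← hFM (max c M) (le_max_right _ _)]
    exact hFanti (le_max_left _ _)
  let A : Set (Esp n) := {x ∈ V | H x ∈ Icc m M}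
  have hAc : IsCompact A := hproper _ isCompact_Icc
  have hAV : A ⊆ V := fun x hx => hx.1
  let G : Esp n → ℝ := fun x => if x ∈ V then F (H x) else 0
  have hGV : ∀ x ∈ V, G x = F (H x) := fun x hx => if_pos hx
  have hGA : ∀ x, x ∉ A → G x = 0 := by
    intro x hx
    by_cases hxV : x ∈ V
    · rw [hGV x hxV]
      apply hFM
      by_contra! h
      exact hx ⟨hxV, hmin x hxV, h.le⟩
    · exact if_neg hxV
  have hGeqV : ∀ x ∈ V, G =ᶠ[𝓝 x] fun y => F (H y) := fun x hx =>
    Filter.eventuallyEq_of_mem (hV.mem_nhds hx) hGV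
  have hGeqA : ∀ x, x ∉ A → G =ᶠ[𝓝 x] fun _ => 0 := fun x hx =>
    Filter.eventuallyEq_of_mem (hAc.isClosed.isOpen_compl.mem_nhds hx) hGA
  have hGs : ContDiff ℝ (⊤ : ℕ∞) G := by
    rw [contDiff_iff_contDiffAt]
    intro x
    by_cases hx : x ∈ A
    · refine ContDiffAt.congr_of_eventuallyEq ?_ (hGeqV x (hAV hx))
      exact hFs.contDiffAt.comp x (hsm.contDiffAt (hV.mem_nhds (hAV hx)))
    · exact contDiffAt_const.congr_of_eventuallyEq (hGeqA x hx)
  have htsupp : tsupport G ⊆ A := by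
    apply closure_minimal _ hAc.isClosed
    intro x hx
    by_contra h
    exact hx (hGA x h)
  have hcs : HasCompactSupport G := hAc.of_isClosed_subset (isClosed_tsupport G) htsupp
  have hclass : InHclass V Z G := by
    refine ⟨hGs, hcs, htsupp.trans hAV, ⟨V ∩ H ⁻¹' Iio m₀,
      hsm.continuousOn.isOpen_inter_preimage hV isOpen_Iio, ?_, F m, ?_⟩, ?_⟩
    · intro z hz
      refine ⟨hZV hz, ?_⟩
      show H z < m₀
      rw [hconst z hz]; exact hm
    · rintro x ⟨hxV, hx⟩
      rw [hGV x hxV]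
      exact hFm _ (le_of_lt hx)
    · intro z hz x
      rw [hGV z (hZV hz), hconst z hz]
      by_cases hxV : x ∈ V
      · rw [hGV x hxV]; exact hFanti (hmin x hxV)
      · have : G x = 0 := if_neg hxV
        rw [this]; exact hFpos m
  have hVF : ∀ x ∈ V, hamVF G x = (-g (H x)) • hamVF H x := by
    intro x hx
    apply hamVF_smul
    rw [(hGeqV x hx).fderiv_eq]
    have h1 : HasFDerivAt H (fderiv ℝ H x) x :=
      ((hsm.contDiffAt (hV.mem_nhds hx)).differentiableAt (by simp)).hasFDerivAt
    exact ((hF (H x)).comp_hasFDerivAt x h1).fderiv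
  have hVA : ∀ x, x ∉ A → hamVF G x = 0 := by
    intro x hx
    rw [hamVF_eq_zero_iff, (hGeqA x hx).fderiv_eq]
    simp
  obtain ⟨L, hL⟩ : ∃ L, LipschitzWith L (hamVF G) := by
    obtain ⟨L, hL⟩ := ContDiff.lipschitzWith_of_hasCompactSupport (𝕂 := ℝ) (n := 1)
      (hcs.fderiv ℝ) (hGs.fderiv_right (by norm_cast)) (by simp)
    refine ⟨L, LipschitzWith.of_dist_le_mul fun x y => ?_⟩
    rw [hamVF_dist]
    exact hL.dist_le_mul x y
  have hfast : ¬ HasFastOrbit G := by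
    rintro ⟨γ, T₁, ⟨hT₁, hγ, hper, t₀, t₁, hne⟩, hle⟩
    have hnz : ∀ t, hamVF G (γ t) ≠ 0 := by
      intro t ht
      have : γ = fun _ => γ t := by
        refine ODE_solution_unique_univ (v := fun _ => hamVF G) (s := fun _ => univ) (K := L)
          (t₀ := t) (fun _ => hL.lipschitzOnWith) (fun s => ⟨hγ s, trivial⟩)
          (fun s => ⟨?_, trivial⟩) rfl
        rw [ht]; exact hasDerivAt_const _ _
      apply hne
      rw [this]
    have hγV : ∀ t, γ t ∈ V := fun t => hAV (by
      by_contra h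
      exact hnz t (hVA _ h))
    have hder : ∀ t, HasDerivAt γ ((-g (H (γ t))) • hamVF H (γ t)) t := fun t => by
      rw [← hVF _ (hγV t)]; exact hγ t
    have hHder : ∀ t, HasDerivAt (fun t => H (γ t)) 0 t := by
      intro t
      have h1 : HasFDerivAt H (fderiv ℝ H (γ t)) (γ t) :=
        ((hsm.contDiffAt (hV.mem_nhds (hγV t))).differentiableAt (by simp)).hasFDerivAt
      have h2 := h1.comp_hasDerivAt t (hder t)
      rwa [map_smul, fderiv_hamVF, smul_zero] at h2
    have hHc : ∀ t, H (γ t) = H (γ 0) := fun t =>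
      is_const_of_deriv_eq_zero (fun s => (hHder s).differentiableAt) (fun s => (hHder s).deriv) t 0
    set c := H (γ 0) with hc
    set a := g c with ha
    have ha0 : a ≠ 0 := by
      intro h
      apply hnz 0
      rw [hVF _ (hγV 0), ← hc, ← ha, h]
      simp
    have hapos : 0 < a := lt_of_le_of_ne (hg0 c) ha0.symm
    refine hor c ha0 ⟨fun t => γ (-(a⁻¹ * t)), a * T₁, ⟨by positivity, ?_, ?_, ?_⟩, ?_, ?_⟩
    · intro t
      have h1 : HasDerivAt (fun t : ℝ => -(a⁻¹ * t)) (-a⁻¹) t := by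
        have h0 := ((hasDerivAt_id' t).const_mul a⁻¹).fun_neg
        rw [mul_one] at h0
        exact h0
      have h2 := (hder (-(a⁻¹ * t))).scomp t h1
      rw [hHc, ← ha, smul_smul] at h2
      have h3 : -a⁻¹ * -a = 1 := by field_simp
      rw [h3, one_smul] at h2
      exact h2
    · intro t
      show γ (-(a⁻¹ * (t + a * T₁))) = γ (-(a⁻¹ * t))
      rw [← hper (-(a⁻¹ * (t + a * T₁)))]
      congr 1
      field_simp
      ring
    · refine ⟨-(a * t₀), -(a * t₁), ?_⟩
      have h4 : ∀ s, -(a⁻¹ * -(a * s)) = s := fun s => by field_simp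
      simpa only [h4] using hne
    · calc a * T₁ ≤ a * 1 := by gcongr
        _ ≤ T := by rw [mul_one]; exact hgT c
    · intro t
      exact ⟨hγV _, hHc _⟩
  obtain ⟨z, hz⟩ := hZne
  refine le_sSup ⟨G, hclass, hfast, z, hz, ?_⟩
  rw [hGV z (hZV hz), hconst z hz]

theorem strip_null (V Z : Set (Esp n)) (hV : IsOpen V) (hZne : Z.Nonempty) (hZV : Z ⊆ V)
    (hcap : relCap V Z < ⊤)
    (H : Esp n → ℝ) (hsm : ContDiffOn ℝ (⊤ : ℕ∞) H V)
    (hproper : ∀ s : Set ℝ, IsCompact s → IsCompact {x ∈ V | H x ∈ s})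
    (m : ℝ) (hconst : ∀ z ∈ Z, H z = m) (hmin : ∀ x ∈ V, m ≤ H x)
    (m₀ M : ℝ) (hm : m < m₀) (hM : m₀ ≤ M) (A : Set ℝ)
    (hA : ∀ c ∈ A, ∀ T : ℝ, 0 < T → ∀ᶠ c' in 𝓝 c,
      ¬ ∃ γ T', IsPeriodicOrbit H γ T' ∧ T' ≤ T ∧ ∀ t, γ t ∈ V ∧ H (γ t) = c') :
    MeasureTheory.volume (A ∩ Ioo m₀ M) = 0 := by
  by_contra hne
  have hpos : 0 < MeasureTheory.volume (A ∩ Ioo m₀ M) := pos_iff_ne_zero.2 hne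
  obtain ⟨r, hr0, hr⟩ := ENNReal.lt_iff_exists_nnreal_btwn.1 hpos
  have hr0' : (0 : ℝ) < r := by exact_mod_cast hr0
  set C := (relCap V Z).toReal with hC
  have hC0 : 0 ≤ C := ENNReal.toReal_nonneg
  set T : ℝ := (C + 1) / r with hTdef
  have hT : 0 < T := by positivity
  let G : Set ℝ := interior {c' | ¬ ∃ γ T', IsPeriodicOrbit H γ T' ∧ T' ≤ T ∧
    ∀ t, γ t ∈ V ∧ H (γ t) = c'} ∩ Ioo m₀ M
  have hG : IsOpen G := isOpen_interior.inter isOpen_Ioo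
  have hAG : A ∩ Ioo m₀ M ⊆ G := fun c hc =>
    ⟨mem_interior_iff_mem_nhds.2 (hA c hc.1 T hT), hc.2⟩
  have hrG : (r : ℝ≥0∞) < MeasureTheory.volume G :=
    lt_of_lt_of_le hr (MeasureTheory.measure_mono hAG)
  obtain ⟨K, hKG, hK, hrK⟩ := hG.exists_lt_isCompact hrG
  obtain ⟨f, hf, hf01, hfs, hf1⟩ := exists_contMDiff_support_eq_eq_one_iff
    (n := (⊤ : ℕ∞)) (modelWithCornersSelf ℝ ℝ) hG hK.isClosed hKG
  rw [contMDiff_iff_contDiff] at hf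
  have hf01' : ∀ c, f c ∈ Icc (0 : ℝ) 1 := fun c => hf01 (mem_range_self c)
  have hgne : ∀ c, T * f c ≠ 0 → c ∈ G := fun c hc => by
    rw [← hfs]
    exact right_ne_zero_of_mul hc
  have hgc : Continuous fun c => T * f c := continuous_const.mul hf.continuous
  have hb := capacity_bound V Z hV hZne hZV H hsm hproper m hconst hmin m₀ M hm hM T
    (fun c => T * f c) (contDiff_const.mul hf)
    (fun c => mul_nonneg hT.le (hf01' c).1)
    (fun c => by nlinarith [(hf01' c).2])
    (fun c hc => (hgne c hc).2)
    (fun c hc => interior_subset (hgne c hc).1)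
  have hint : C + 1 ≤ ∫ c in m..M, T * f c := by
    rw [intervalIntegral.integral_of_le (hm.le.trans hM)]
    have h1 : ∫ c in K, T * f c = MeasureTheory.volume.real K * T := by
      rw [MeasureTheory.setIntegral_congr_fun (g := fun _ => T) hK.measurableSet]
      · simp
      · intro c hc
        simp [(hf1 c).1 hc]
    have hKs : K ⊆ Ioc m M := fun c hc =>
      ⟨hm.trans (hKG hc).2.1, (hKG hc).2.2.le⟩
    have h2 : ∫ c in K, T * f c ≤ ∫ c in Ioc m M, T * f c := by
      apply MeasureTheory.setIntegral_mono_set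
      · exact (hgc.integrableOn_Icc (a := m) (b := M)).mono_set Ioc_subset_Icc_self
      · exact Filter.Eventually.of_forall fun c => mul_nonneg hT.le (hf01' c).1
      · exact hKs.eventuallyLE
    have h3 : (r : ℝ) ≤ MeasureTheory.volume.real K := by
      have := ENNReal.toReal_mono hK.measure_lt_top.ne hrK.le
      simpa [MeasureTheory.measureReal_def] using this
    have h4 : (r : ℝ) * T = C + 1 := by
      rw [hTdef]; field_simp
    have h5 := mul_le_mul_of_nonneg_right h3 hT.le
    linarith
  have h6 := (ENNReal.ofReal_le_ofReal hint).trans hb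
  rw [ENNReal.ofReal_le_iff_le_toReal hcap.ne] at h6
  linarith

/-- **Relative almost existence theorem (Theorem 2.10 of Ginzburg–Gürel)** for
open subsets of standard `ℝ^{2n}`: if `c_HZ(V, Z) < ∞` and `H : V → ℝ` is a
proper smooth function constant on `Z` with `H|_Z = min H`, then the set of
values `c` whose level set `{x ∈ V | H x = c}` is nonempty but carries no
nonconstant periodic orbit of the Hamiltonian flow of `H` has Lebesgue measure
zero. -/
theorem stmt_6 (n : ℕ) (hn : 1 ≤ n) (V Z : Set (Esp n)) (hV : IsOpen V)
    (hZcpt : IsCompact Z) (hZne : Z.Nonempty) (hZV : Z ⊆ V)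
    (hcap : relCap V Z < ⊤)
    (H : Esp n → ℝ)
    (hsm : ContDiffOn ℝ (⊤ : ℕ∞) H V)
    (hproper : ∀ s : Set ℝ, IsCompact s → IsCompact {x ∈ V | H x ∈ s})
    (hconst : ∃ c : ℝ, ∀ z ∈ Z, H z = c)
    (hmin : ∀ z ∈ Z, ∀ x ∈ V, H z ≤ H x) :
    MeasureTheory.volume {c : ℝ | (∃ x ∈ V, H x = c) ∧
      ¬ ∃ γ T, IsPeriodicOrbit H γ T ∧ ∀ t, γ t ∈ V ∧ H (γ t) = c} = 0 := by
  obtain ⟨m, hm⟩ := hconst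
  obtain ⟨z, hz⟩ := hZne
  have hmin' : ∀ x ∈ V, m ≤ H x := fun x hx => by
    rw [← hm z hz]
    exact hmin z hz x hx
  set S := {c : ℝ | (∃ x ∈ V, H x = c) ∧
      ¬ ∃ γ T, IsPeriodicOrbit H γ T ∧ ∀ t, γ t ∈ V ∧ H (γ t) = c} with hS
  set R := {c : ℝ | ∀ x ∈ V, H x = c → fderiv ℝ H x ≠ 0} with hR
  have hcrit : MeasureTheory.volume (H '' {x ∈ V | fderiv ℝ H x = 0}) = 0 := by
    apply sard_aux (Module.finrank ℝ (Esp n)) rfl H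
    · intro x hx
      refine (hsm.contDiffAt (hV.mem_nhds hx.1)).of_le ?_
      exact_mod_cast le_top
    · exact fun x hx => hx.2
  have hstrip : ∀ k : ℕ, MeasureTheory.volume
      ((S ∩ R) ∩ Ioo (m + 1 / ((k : ℝ) + 1)) (m + 1 / ((k : ℝ) + 1) + (k : ℝ))) = 0 := by
    intro k
    have hk : (0 : ℝ) < 1 / ((k : ℝ) + 1) := by positivity
    have hk' : (0 : ℝ) ≤ (k : ℝ) := by positivity
    refine strip_null V Z hV ⟨z, hz⟩ hZV hcap H hsm hproper m hm hmin' _ _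
      (by linarith) (by linarith) _ ?_
    intro c hc T hT
    exact no_short_orbits_nearby V hV H hsm hproper c hc.2 hc.1.2 T hT
  refine MeasureTheory.measure_mono_null (t := ({m} ∪ H '' {x ∈ V | fderiv ℝ H x = 0}) ∪
    ⋃ k : ℕ, ((S ∩ R) ∩ Ioo (m + 1 / ((k : ℝ) + 1)) (m + 1 / ((k : ℝ) + 1) + (k : ℝ)))) ?_ ?_
  · intro c hc
    by_cases hcR : c ∈ R
    · by_cases hcm : c = m
      · exact Or.inl (Or.inl hcm)
      · right
        obtain ⟨x, hxV, hxc⟩ := hc.1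
        have hlt : 0 < c - m := by
          have h1 := hmin' x hxV
          rw [hxc] at h1
          exact sub_pos.2 (lt_of_le_of_ne h1 (Ne.symm hcm))
        obtain ⟨k₁, hk₁⟩ := exists_nat_one_div_lt hlt
        obtain ⟨k₂, hk₂⟩ := exists_nat_gt (c - m)
        rw [mem_iUnion]
        refine ⟨max k₁ k₂, ⟨hc, hcR⟩, ?_, ?_⟩
        · have h2 : (1 : ℝ) / (((max k₁ k₂ : ℕ) : ℝ) + 1) ≤ 1 / ((k₁ : ℝ) + 1) := by
            have : (k₁ : ℝ) ≤ ((max k₁ k₂ : ℕ) : ℝ) := by exact_mod_cast le_max_left _ _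
            gcongr
          linarith
        · have h2 : (k₂ : ℝ) ≤ ((max k₁ k₂ : ℕ) : ℝ) := by exact_mod_cast le_max_right _ _
          have h3 : (0 : ℝ) < 1 / (((max k₁ k₂ : ℕ) : ℝ) + 1) := by positivity
          linarith
    · left
      right
      simp only [hR, mem_setOf_eq, not_forall, not_not] at hcR
      obtain ⟨x, hxV, hxc, hx0⟩ := hcR
      exact ⟨x, ⟨hxV, hx0⟩, hxc⟩
  · exact MeasureTheory.measure_union_null
      (MeasureTheory.measure_union_null Real.volume_singleton hcrit)
      (MeasureTheory.measure_iUnion_null hstrip)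
end
end
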